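/- arXiv:2102.10654 — 3 statements merged into one kernel-verified Lean document; each statement's English description precedes it below -/
import Mathlib

section
/- For every setting with n agents whose valuations are nice cancelable (this includes all additive valuations), there exists a partial EFX allocation in which at most n−2 items are unallocated; moreover, no agent envies the set of unallocated items. -/
namespace FairDivision

open Finset

/-- A valuation: nonnegative, zero on the empty set, monotone. -/
def IsValuation {ι : Type*} (v : Finset ι → ℝ) : Prop :=
  v ∅ = 0 ∧ (∀ S : Finset ι, 0 ≤ v S) ∧ ∀ ⦃S T : Finset ι⦄, S ⊆ T → v S ≤ v T

/-- `v` is cancelable: `v (S ∪ {g}) > v (T ∪ {g})` implies `v S > v T`. -/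
def Cancelable {ι : Type*} [DecidableEq ι] (v : Finset ι → ℝ) : Prop :=
  ∀ S T : Finset ι, ∀ g : ι, g ∉ S → g ∉ T →
    v (insert g S) > v (insert g T) → v S > v T

/-- `v` is non-degenerate: distinct bundles have distinct values. -/
def NonDegenerate {ι : Type*} (v : Finset ι → ℝ) : Prop :=
  ∀ S T : Finset ι, S ≠ T → v S ≠ v T

/-- `v'` respects `v`: every strict inequality of `v` is a strict inequality of `v'`. -/
def Respects {ι : Type*} (v' v : Finset ι → ℝ) : Prop :=
  ∀ S T : Finset ι, v S > v T → v' S > v' T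

/-- `v` is a nice cancelable valuation: cancelable, and some non-degenerate
cancelable valuation respects it. -/
def NiceCancelable {ι : Type*} [DecidableEq ι] (v : Finset ι → ℝ) : Prop :=
  Cancelable v ∧ ∃ v' : Finset ι → ℝ,
    IsValuation v' ∧ NonDegenerate v' ∧ Cancelable v' ∧ Respects v' v

/-- A partial allocation: the bundles are pairwise disjoint. -/
def IsPartialAlloc {ι : Type*} {n : ℕ} (X : Fin n → Finset ι) : Prop :=
  ∀ i j : Fin n, i ≠ j → Disjoint (X i) (X j)

/-- The set of unallocated items. -/
def unalloc {ι : Type*} [DecidableEq ι] [Fintype ι] {n : ℕ}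
    (X : Fin n → Finset ι) : Finset ι :=
  Finset.univ \ Finset.univ.biUnion X

/-- Agent `i` envies the set `S`. -/
def EnviesSet {ι : Type*} {n : ℕ} (v : Fin n → Finset ι → ℝ) (X : Fin n → Finset ι)
    (i : Fin n) (S : Finset ι) : Prop :=
  v i (X i) < v i S

/-- Agent `i` strongly envies the set `S`. -/
def StrongEnviesSet {ι : Type*} [DecidableEq ι] {n : ℕ} (v : Fin n → Finset ι → ℝ)
    (X : Fin n → Finset ι) (i : Fin n) (S : Finset ι) : Prop :=
  ∃ h ∈ S, v i (X i) < v i (S.erase h)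

/-- The allocation is EFX: no agent strongly envies another agent's bundle. -/
def IsEFX {ι : Type*} [DecidableEq ι] {n : ℕ} (v : Fin n → Finset ι → ℝ)
    (X : Fin n → Finset ι) : Prop :=
  ∀ i j : Fin n, i ≠ j → ¬ StrongEnviesSet v X i (X j)

/-- `Y` Pareto dominates `X`. -/
def ParetoDominates {ι : Type*} {n : ℕ} (v : Fin n → Finset ι → ℝ)
    (Y X : Fin n → Finset ι) : Prop :=
  (∀ i, v i (X i) ≤ v i (Y i)) ∧ ∃ i, v i (X i) < v i (Y i)

/-- `Y` dominates `X` lexicographically with respect to the ordering `a` of the agents. -/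
def Dominates {ι : Type*} {n : ℕ} (v : Fin n → Finset ι → ℝ) (a : Fin n → Fin n)
    (Y X : Fin n → Finset ι) : Prop :=
  ∃ k : Fin n, (∀ j : Fin n, j < k → v (a j) (Y (a j)) = v (a j) (X (a j))) ∧
    v (a k) (X (a k)) < v (a k) (Y (a k))

/-- Agent `i` is a most envious agent of the set `S`: there is `T ⊆ S` that `i`
envies and that no agent strongly envies.  (`S \ T` is a corresponding discard set.) -/
def MostEnvious {ι : Type*} [DecidableEq ι] {n : ℕ} (v : Fin n → Finset ι → ℝ)
    (X : Fin n → Finset ι) (i : Fin n) (S : Finset ι) : Prop :=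
  ∃ T ⊆ S, EnviesSet v X i T ∧ ∀ j : Fin n, ¬ StrongEnviesSet v X j T

/-- `i` champions `j` with respect to the item `g`:  `i` is a most envious agent
of `X j ∪ {g}`. -/
def ChampG {ι : Type*} [DecidableEq ι] {n : ℕ} (v : Fin n → Finset ι → ℝ)
    (X : Fin n → Finset ι) (g : ι) (i j : Fin n) : Prop :=
  MostEnvious v X i (insert g (X j))

/-- `i` champions `j` with respect to `(H | S)`:  `H ⊆ M \ X j`, `S ⊆ X j`, and `i`
is a most envious agent of `(X j \ S) ∪ H`. -/
def GenChamp {ι : Type*} [DecidableEq ι] {n : ℕ} (v : Fin n → Finset ι → ℝ)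
    (X : Fin n → Finset ι) (i j : Fin n) (H S : Finset ι) : Prop :=
  Disjoint H (X j) ∧ S ⊆ X j ∧ MostEnvious v X i ((X j \ S) ∪ H)

theorem NonDegenerate.strictMono {ι : Type*} {w : Finset ι → ℝ} (hw : IsValuation w)
    (hd : NonDegenerate w) {S T : Finset ι} (h : S ⊂ T) : w S < w T :=
  lt_of_le_of_ne (hw.2.2 h.1) (hd S T h.ne)

section Helpers

variable {ι : Type*} [DecidableEq ι] {n : ℕ} {v : Fin n → Finset ι → ℝ}
  {X : Fin n → Finset ι}

theorem Cancelable.lt_of_union_lt {w : Finset ι → ℝ} (hc : Cancelable w) (R : Finset ι) :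
    ∀ {S T : Finset ι}, Disjoint S R → Disjoint T R → w (S ∪ R) < w (T ∪ R) → w S < w T := by
  induction R using Finset.induction_on with
  | empty => intro S T _ _ h; simpa using h
  | insert g R hg ih =>
    intro S T hS hT h
    rw [disjoint_insert_right] at hS hT
    refine ih hS.2 hT.2 (hc (T ∪ R) (S ∪ R) g ?_ ?_ ?_)
    · simp [hT.1, hg]
    · simp [hS.1, hg]
    · simpa [union_insert] using h

theorem Cancelable.union_lt_union {w : Finset ι → ℝ} (hc : Cancelable w)
    (hd : NonDegenerate w) {R S T : Finset ι} (hS : Disjoint S R) (hT : Disjoint T R)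
    (h : w S < w T) : w (S ∪ R) < w (T ∪ R) := by
  by_contra! hle
  rcases hle.lt_or_eq with hlt | heq
  · exact absurd (hc.lt_of_union_lt R hT hS hlt) h.not_gt
  · have hne : T ∪ R ≠ S ∪ R := by
      intro he
      have hTS : T = S := by
        rw [← union_sdiff_cancel_right hT, he, union_sdiff_cancel_right hS]
      exact h.ne (by rw [hTS])
    exact hd _ _ hne heq

/-- `X` is an allocation in which no agent strongly envies any bundle, and which admits no
Pareto improvement by bundles that no agent strongly envies under `X`. -/
structure IsUnimprovable (v : Fin n → Finset ι → ℝ) (X : Fin n → Finset ι) : Prop where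
  alloc : IsPartialAlloc X
  safe : ∀ k j, ¬ StrongEnviesSet v X j (X k)
  maximal : ∀ Y : Fin n → Finset ι, IsPartialAlloc Y →
    (∀ k j, ¬ StrongEnviesSet v X j (Y k)) → (∀ k, v k (X k) ≤ v k (Y k)) →
    ∀ k, ¬ v k (X k) < v k (Y k)

theorem IsEFX.not_strongEnvies_bundle (hval : ∀ i, IsValuation (v i)) (hE : IsEFX v X)
    (k j : Fin n) : ¬ StrongEnviesSet v X j (X k) := by
  by_cases h : j = k
  · rintro ⟨a, -, ha⟩
    subst h
    exact absurd ((hval j).2.2 (erase_subset a (X j))) ha.not_ge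
  · exact hE j k h

theorem exists_isUnimprovable [Fintype ι] (v : Fin n → Finset ι → ℝ)
    (hval : ∀ i, IsValuation (v i)) :
    ∃ X : Fin n → Finset ι, IsEFX v X ∧ IsUnimprovable v X := by
  classical
  obtain ⟨X, hX, hmax⟩ := Finset.exists_max_image
    (univ.filter fun X : Fin n → Finset ι => IsPartialAlloc X ∧ IsEFX v X)
    (fun X => ∑ i, v i (X i))
    ⟨fun _ => ∅, by simp [IsPartialAlloc, IsEFX, StrongEnviesSet]⟩
  simp only [mem_filter, mem_univ, true_and] at hX hmax
  refine ⟨X, hX.2, hX.1, hX.2.not_strongEnvies_bundle hval, fun Y hY hsafe hle k hk => ?_⟩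
  refine absurd (hmax Y ⟨hY, ?_⟩) (sum_lt_sum (fun i _ => hle i) ⟨k, mem_univ k, hk⟩).not_ge
  rintro i j - ⟨a, ha, hlt⟩
  exact hsafe j i ⟨a, ha, (hle i).trans_lt hlt⟩

theorem exists_mostEnvious {i : Fin n} {S : Finset ι} (h : EnviesSet v X i S) :
    ∃ k, MostEnvious v X k S := by
  induction S using Finset.strongInduction generalizing i with
  | H S ih =>
    by_cases hs : ∃ j, StrongEnviesSet v X j S
    · obtain ⟨j, a, ha, hlt⟩ := hs
      obtain ⟨k, T, hT, hk⟩ := ih (S.erase a) (erase_ssubset ha) hlt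
      exact ⟨k, T, hT.trans (erase_subset a S), hk⟩
    · exact ⟨i, S, Subset.rfl, h, not_exists.1 hs⟩

theorem MostEnvious.mono {i : Fin n} {S T : Finset ι} (h : MostEnvious v X i S) (hST : S ⊆ T) :
    MostEnvious v X i T := by
  obtain ⟨R, hR, h⟩ := h
  exact ⟨R, hR.trans hST, h⟩

variable [Fintype ι]

theorem disjoint_unalloc (k : Fin n) : Disjoint (unalloc X) (X k) := by
  rw [unalloc]
  exact disjoint_sdiff_self_left.mono_right (subset_biUnion_of_mem X (mem_univ k))

theorem IsUnimprovable.not_enviesSet_unalloc (hX : IsUnimprovable v X) (i : Fin n) :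
    ¬ EnviesSet v X i (unalloc X) := by
  intro h
  obtain ⟨k, T, hT, hk, hsafe⟩ := exists_mostEnvious h
  refine hX.maximal (Function.update X k T) ?_ ?_ ?_ k
    (by rw [Function.update_self]; exact hk)
  · intro a b hab
    rcases eq_or_ne a k with rfl | ha
    · rw [Function.update_self, Function.update_of_ne hab.symm]
      exact (disjoint_unalloc b).mono_left hT
    · rw [Function.update_of_ne ha]
      rcases eq_or_ne b k with rfl | hb
      · rw [Function.update_self]
        exact ((disjoint_unalloc a).mono_left hT).symm
      · rw [Function.update_of_ne hb]
        exact hX.alloc a b hab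
  · intro a
    rcases eq_or_ne a k with rfl | ha
    · simpa using hsafe
    · simpa [ha] using hX.safe a
  · intro a
    rcases eq_or_ne a k with rfl | ha
    · simpa using le_of_lt hk
    · simp [ha]

/-- In an unimprovable allocation, no cycle of agents can pass bundles along the cycle, each
agent `u (s + 1)` taking `S s` out of the bundle of `u s`, some unallocated items, and a set `B`
released within the cycle. -/
theorem IsUnimprovable.no_improving_cycle (hX : IsUnimprovable v X) {m : ℕ} (hm : 0 < m)
    (u : ℕ → Fin n) (hu : u m = u 0) (hinj : ∀ s < m, ∀ s' < m, s ≠ s' → u s ≠ u s')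
    (B : Finset ι) (S G : ℕ → Finset ι) (hS : ∀ s < m, S s ⊆ (X (u s) \ B) ∪ G s)
    (hG : ∀ s < m, ∀ s' < m, s ≠ s' → Disjoint (G s) (G s'))
    (hGU : ∀ s < m, G s ⊆ unalloc X ∪ B)
    (hB : ∀ k, (∀ s < m, u s ≠ k) → Disjoint B (X k))
    (henv : ∀ s < m, EnviesSet v X (u (s + 1)) (S s))
    (hsafe : ∀ s < m, ∀ j, ¬ StrongEnviesSet v X j (S s)) : False := by
  classical
  have hGX : ∀ s < m, ∀ k, Disjoint (X k \ B) (G s) := fun s hs k =>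
    (disjoint_union_right.2 ⟨((disjoint_unalloc k).mono_right sdiff_subset).symm,
      disjoint_sdiff_self_left⟩).mono_right (hGU s hs)
  have hSS : ∀ s < m, ∀ s' < m, s ≠ s' → Disjoint (S s) (S s') := by
    intro s hs s' hs' hne
    refine Disjoint.mono (hS s hs) (hS s' hs') ?_
    rw [disjoint_union_left, disjoint_union_right, disjoint_union_right]
    exact ⟨⟨(hX.alloc _ _ (hinj s hs s' hs' hne)).mono sdiff_subset sdiff_subset,
      hGX s' hs' _⟩, (hGX s hs _).symm, hG s hs s' hs' hne⟩
  have hrot : ∀ k, (¬ ∃ s, s < m ∧ u (s + 1) = k) → ∀ s < m, u s ≠ k := by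
    rintro k hk s hs rfl
    rcases s with _ | s
    · exact hk ⟨m - 1, by omega, by rw [Nat.sub_add_cancel hm, hu]⟩
    · exact hk ⟨s, by omega, rfl⟩
  have hSX : ∀ s < m, ∀ k, (¬ ∃ s, s < m ∧ u (s + 1) = k) → Disjoint (S s) (X k) := by
    intro s hs k hk
    refine Disjoint.mono_left (hS s hs) (disjoint_union_left.2
      ⟨(hX.alloc _ _ (hrot k hk s hs)).mono_left sdiff_subset, ?_⟩)
    exact (disjoint_union_left.2 ⟨disjoint_unalloc k, hB k (hrot k hk)⟩).mono_left (hGU s hs)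
  let Y : Fin n → Finset ι := fun k =>
    if h : ∃ s, s < m ∧ u (s + 1) = k then S h.choose else X k
  have hYin : ∀ k, (∃ s, s < m ∧ u (s + 1) = k) →
      ∃ s, s < m ∧ u (s + 1) = k ∧ Y k = S s := fun k h =>
    ⟨h.choose, h.choose_spec.1, h.choose_spec.2, dif_pos h⟩
  have hYout : ∀ k, (¬ ∃ s, s < m ∧ u (s + 1) = k) → Y k = X k := fun k h => dif_neg h
  obtain ⟨s₀, hs₀, hu₀, hY₀⟩ := hYin (u (0 + 1)) ⟨0, hm, rfl⟩
  refine hX.maximal Y ?_ ?_ ?_ (u (0 + 1)) (by rw [hY₀, ← hu₀]; exact henv s₀ hs₀)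
  · intro a b hab
    by_cases ha : ∃ s, s < m ∧ u (s + 1) = a
    · obtain ⟨s, hs, hsa, hYa⟩ := hYin a ha
      rw [hYa]
      by_cases hb : ∃ s, s < m ∧ u (s + 1) = b
      · obtain ⟨s', hs', hsb, hYb⟩ := hYin b hb
        rw [hYb]
        refine hSS s hs s' hs' ?_
        rintro rfl
        exact hab (hsa.symm.trans hsb)
      · rw [hYout b hb]
        exact hSX s hs b hb
    · rw [hYout a ha]
      by_cases hb : ∃ s, s < m ∧ u (s + 1) = b
      · obtain ⟨s', hs', hsb, hYb⟩ := hYin b hb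
        rw [hYb]
        exact (hSX s' hs' a ha).symm
      · rw [hYout b hb]
        exact hX.alloc a b hab
  · intro k
    by_cases hk : ∃ s, s < m ∧ u (s + 1) = k
    · obtain ⟨s, hs, -, hY⟩ := hYin k hk
      rw [hY]
      exact hsafe s hs
    · rw [hYout k hk]
      exact hX.safe k
  · intro k
    by_cases hk : ∃ s, s < m ∧ u (s + 1) = k
    · obtain ⟨s, hs, hsk, hY⟩ := hYin k hk
      rw [hY, ← hsk]
      exact (henv s hs).le
    · rw [hYout k hk]

/-- Along a walk of champions with distinct items, no agent is repeated. -/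
theorem IsUnimprovable.rainbow_walk_ne (hX : IsUnimprovable v X) (w : ℕ → Fin n) (γ : ℕ → ι)
    {L : ℕ} (hγU : ∀ l < L, γ l ∈ unalloc X) (hw : ∀ l < L, ChampG v X (γ l) (w (l + 1)) (w l))
    (d : ℕ) : ∀ {a b : ℕ}, b = a + d → a < b → b ≤ L →
    (∀ s < b, ∀ s' < b, a ≤ s → a ≤ s' → s ≠ s' → γ s ≠ γ s') → w a ≠ w b := by
  induction d using Nat.strong_induction_on with
  | _ d ih =>
    intro a b hb hab hbL hγ hwab
    have hch : ∀ s < d, ChampG v X (γ (a + s)) (w (a + s + 1)) (w (a + s)) :=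
      fun s hs => hw (a + s) (by omega)
    have hne : ∀ s s', s < s' → s' < d → w (a + s) ≠ w (a + s') := fun s s' hss hs' =>
      ih (s' - s) (by omega) (by omega) (by omega) (by omega)
        fun x hx y hy hax hay => hγ x (by omega) y (by omega) (by omega) (by omega)
    choose! S hS henv hsafe using hch
    refine hX.no_improving_cycle (m := d) (by omega) (fun s => w (a + s))
      (by simp [← hb, hwab]) ?_ ∅ S (fun s => {γ (a + s)}) ?_ ?_ ?_ (by simp) henv hsafe
    · intro s hs s' hs' hss
      rcases hss.lt_or_gt with h | h
      · exact hne s s' h hs'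
      · exact (hne s' s h hs).symm
    · intro s hs
      refine (hS s hs).trans ?_
      rw [sdiff_empty, insert_eq, union_comm]
    · intro s hs s' hs' hss
      rw [disjoint_singleton]
      exact hγ _ (by omega) _ (by omega) (by omega) (by omega) (by omega)
    · intro s hs
      rw [union_empty, singleton_subset_iff]
      exact hγU _ (by omega)

/-- A walk of champions along items of which any `n - 1` consecutive ones are distinct is
periodic with period `n`. -/
theorem IsUnimprovable.walk_periodic (hX : IsUnimprovable v X) (hn : 0 < n) (w : ℕ → Fin n)
    (γ : ℕ → ι) (hγU : ∀ l, γ l ∈ unalloc X) (hw : ∀ l, ChampG v X (γ l) (w (l + 1)) (w l))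
    (hγ : ∀ a b, a < b → b - a < n - 1 → γ a ≠ γ b) :
    (∀ a b, a < b → b - a < n → w a ≠ w b) ∧ ∀ l, w (l + n) = w l := by
  have hne : ∀ a b, a < b → b - a < n → w a ≠ w b := by
    intro a b hab hlt
    refine hX.rainbow_walk_ne w γ (L := b) (fun l _ => hγU l) (fun l _ => hw l) (b - a)
      (by omega) hab le_rfl ?_
    intro s hs s' hs' has has' hss
    rcases hss.lt_or_gt with h | h
    · exact hγ s s' h (by omega)
    · exact (hγ s' s h (by omega)).symm
  refine ⟨hne, fun l => ?_⟩
  have hinj : Function.Injective fun t : Fin n => w (l + 1 + t) := by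
    intro s t hst
    by_contra hne'
    rcases lt_or_gt_of_ne hne' with h | h
    · exact hne _ _ (Nat.add_lt_add_left h (l + 1)) (by omega) hst
    · exact hne _ _ (Nat.add_lt_add_left h (l + 1)) (by omega) hst.symm
  obtain ⟨t, ht⟩ := (Finite.injective_iff_surjective.1 hinj) (w l)
  have ht : w (l + 1 + t) = w l := ht
  by_cases h : (t : ℕ) = n - 1
  · rw [← ht]
    congr 1
    omega
  · exact absurd ht.symm (hne _ _ (by omega) (by omega))

end Helpers

theorem exists_seq_of_le_card {ι : Type*} {U : Finset ι} {p : ℕ} (hp : 0 < p)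
    (hU : p ≤ U.card) {g h : ι} (hg : g ∈ U) (hh : h ∈ U) (hgh : 2 ≤ p → g ≠ h) :
    ∃ γ : ℕ → ι, (∀ l, γ l ∈ U) ∧ (∀ a b, a < b → b - a < p → γ a ≠ γ b) ∧
      γ 0 = g ∧ γ (p + 1) = h := by
  classical
  rcases Nat.lt_or_ge p 2 with hp2 | hp2
  · refine ⟨fun l => if l = 0 then g else h, fun l => ?_, fun a b _ _ => ?_, ?_, ?_⟩
    · dsimp only
      split_ifs <;> assumption
    · omega
    · simp
    · simp
  · specialize hgh hp2
    let e : Fin U.card ≃ U := U.equivFin.symm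
    let e₁ : Fin U.card ≃ U := e.trans (Equiv.swap (e ⟨0, by omega⟩) ⟨g, hg⟩)
    let e₂ : Fin U.card ≃ U := e₁.trans (Equiv.swap (e₁ ⟨1, by omega⟩) ⟨h, hh⟩)
    have h1 : e₁ ⟨0, by omega⟩ = ⟨g, hg⟩ := by simp [e₁]
    have h20 : e₂ ⟨0, by omega⟩ = ⟨g, hg⟩ := by
      simp only [e₂, Equiv.trans_apply, h1]
      refine Equiv.swap_apply_of_ne_of_ne ?_ (by simpa using hgh)
      rw [← h1]
      exact fun hc => by simpa using e₁.injective hc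
    have h21 : e₂ ⟨1, by omega⟩ = ⟨h, hh⟩ := by simp [e₂]
    have hlt : ∀ l, l % p < U.card := fun l => (Nat.mod_lt l hp).trans_le hU
    refine ⟨fun l => e₂ ⟨l % p, hlt l⟩, fun l => (e₂ _).2, fun a b hab hlt' hc => ?_, ?_, ?_⟩
    · have hmod : a % p = b % p := by simpa using e₂.injective (Subtype.ext hc)
      have hdvd : p ∣ b - a := (Nat.modEq_iff_dvd' hab.le).1 hmod
      exact absurd (Nat.le_of_dvd (by omega) hdvd) (by omega)
    · simp [h20]
    · have : (p + 1) % p = 1 := by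
        rw [Nat.add_mod_left, Nat.mod_eq_of_lt (by omega)]
      simp [this, h21]

section Champions

variable {ι : Type*} [DecidableEq ι] [Fintype ι] {n : ℕ} {v : Fin n → Finset ι → ℝ}
  {X : Fin n → Finset ι}

theorem exists_champG (hval : ∀ i, IsValuation (v i)) (hd : ∀ i, NonDegenerate (v i))
    (j : Fin n) {g : ι} (hg : g ∈ unalloc X) : ∃ c, ChampG v X g c j :=
  exists_mostEnvious (i := j) ((hd j).strictMono (hval j)
    (ssubset_insert (disjoint_left.1 (disjoint_unalloc j) hg)))

theorem IsUnimprovable.champG_unique_of_ne (hX : IsUnimprovable v X) (hn : 2 ≤ n)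
    (hU : n - 1 ≤ (unalloc X).card) (hex : ∀ j, ∀ g ∈ unalloc X, ∃ c, ChampG v X g c j)
    {j c c' : Fin n} {g h : ι} (hg : g ∈ unalloc X) (hh : h ∈ unalloc X)
    (hgh : 3 ≤ n → g ≠ h) (hc : ChampG v X g c j) (hc' : ChampG v X h c' j) : c = c' := by
  choose! C hC using hex
  obtain ⟨γ, hγU, hγ, hγ0, hγn⟩ := exists_seq_of_le_card (p := n - 1) (by omega) hU hg hh
    (fun hp => hgh (by omega))
  rw [show n - 1 + 1 = n by omega] at hγn
  let P : ℕ → Fin n → Fin n := fun l x =>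
    if x = j ∧ l = 0 then c else if x = j ∧ l = n then c' else C x (γ l)
  have hP : ∀ l x, ChampG v X (γ l) (P l x) x := by
    intro l x
    simp only [P]
    split_ifs with h1 h2
    · rwa [h1.1, h1.2, hγ0]
    · rwa [h2.1, h2.2, hγn]
    · exact hC x _ (hγU l)
  let w : ℕ → Fin n := fun l => Nat.rec j (fun l x => P l x) l
  have hws : ∀ l, w (l + 1) = P l (w l) := fun l => rfl
  obtain ⟨-, hper⟩ := hX.walk_periodic (by omega) w γ hγU (fun l => by rw [hws]; exact hP l _) hγ
  have h0 : w 0 = j := rfl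
  have h1 : w 1 = c := by
    change P 0 j = c
    simp [P]
  have hn1 : w (n + 1) = c' := by
    have hwn : w n = j := by rw [← h0, ← hper 0, zero_add]
    rw [hws n, hwn]
    simp [P, show n ≠ 0 by omega]
  rw [← h1, ← hn1, ← hper 1, add_comm]

/-- Every agent has a unique champion, the same for all unallocated items. -/
theorem IsUnimprovable.champG_unique (hX : IsUnimprovable v X) (hn : 2 ≤ n)
    (hU : n - 1 ≤ (unalloc X).card) (hex : ∀ j, ∀ g ∈ unalloc X, ∃ c, ChampG v X g c j)
    {j c c' : Fin n} {g h : ι} (hg : g ∈ unalloc X) (hh : h ∈ unalloc X)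
    (hc : ChampG v X g c j) (hc' : ChampG v X h c' j) : c = c' := by
  by_cases hcase : 3 ≤ n → g ≠ h
  · exact hX.champG_unique_of_ne hn hU hex hg hh hcase hc hc'
  · push Not at hcase
    obtain ⟨h3, rfl⟩ := hcase
    obtain ⟨k, hk, hkg⟩ := exists_mem_ne (by omega : 1 < (unalloc X).card) g
    obtain ⟨c'', hc''⟩ := hex j k hk
    rw [hX.champG_unique_of_ne hn hU hex hg hk (fun _ => hkg.symm) hc hc'',
      hX.champG_unique_of_ne hn hU hex hg hk (fun _ => hkg.symm) hc' hc'']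

theorem IsUnimprovable.card_unalloc_lt (hX : IsUnimprovable v X) (hn : 2 ≤ n)
    (hval : ∀ i, IsValuation (v i)) (hd : ∀ i, NonDegenerate (v i))
    (hcan : ∀ i, Cancelable (v i)) : (unalloc X).card < n - 1 := by
  by_contra! hU
  have hex : ∀ j, ∀ g ∈ unalloc X, ∃ c, ChampG v X g c j := fun j g hg =>
    exists_champG hval hd j hg
  have huniq : ∀ {j c c' : Fin n} {g h : ι}, g ∈ unalloc X → h ∈ unalloc X →
      ChampG v X g c j → ChampG v X h c' j → c = c' := hX.champG_unique hn hU hex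
  obtain ⟨γ, hγU, hγ⟩ : ∃ γ : ℕ → ι, (∀ l, γ l ∈ unalloc X) ∧
      ∀ a b, a < b → b - a < n - 1 → γ a ≠ γ b := by
    obtain ⟨g, hg⟩ := card_pos.1 (by omega : 0 < (unalloc X).card)
    by_cases h3 : 3 ≤ n
    · obtain ⟨h, hh, hhg⟩ := exists_mem_ne (by omega : 1 < (unalloc X).card) g
      obtain ⟨γ, h1, h2, -⟩ := exists_seq_of_le_card (by omega) hU hg hh (fun _ => hhg.symm)
      exact ⟨γ, h1, h2⟩
    · exact ⟨fun _ => g, fun _ => hg, fun a b _ _ => by omega⟩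
  have hγ' : ∀ a b, a ≠ b → a - b < n - 1 → b - a < n - 1 → γ a ≠ γ b := by
    intro a b hab h1 h2
    rcases hab.lt_or_gt with h | h
    · exact hγ a b h h2
    · exact (hγ b a h h1).symm
  choose! C hC using hex
  let τ : Fin n → Fin n := fun j => C j (γ 0)
  have hτ : ∀ j, ∀ g ∈ unalloc X, ChampG v X g (τ j) j := by
    intro j g hg
    have h : τ j = C j g := huniq (hγU 0) hg (hC j _ (hγU 0)) (hC j g hg)
    rw [h]
    exact hC j g hg
  have hτu : ∀ {j c g}, g ∈ unalloc X → ChampG v X g c j → c = τ j := fun hg hc =>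
    huniq hg hg hc (hτ _ _ hg)
  have hwalk : ∀ i, ∃ w : ℕ → Fin n, w 0 = i ∧ (∀ l, w (l + 1) = τ (w l)) ∧
      (∀ a b, a ≠ b → a - b < n → b - a < n → w a ≠ w b) ∧ ∀ l, w (l + n) = w l := by
    intro i
    have hs : ∀ l, τ^[l + 1] i = τ (τ^[l] i) := fun l => Function.iterate_succ_apply' τ l i
    obtain ⟨h1, h2⟩ := hX.walk_periodic (by omega) (fun l => τ^[l] i) γ hγU
      (fun l => by rw [hs]; exact hτ _ _ (hγU l)) hγ
    refine ⟨fun l => τ^[l] i, rfl, hs, fun a b hab hlt hlt' => ?_, h2⟩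
    rcases hab.lt_or_gt with h | h
    · exact h1 a b h hlt'
    · exact (h1 b a h hlt).symm
  -- The allocation is envy-free.
  have hEF : ∀ c j, v c (X j) ≤ v c (X c) := by
    intro c j
    by_contra! henvy
    obtain ⟨k, hk⟩ := exists_mostEnvious (v := v) (X := X) (i := c) henvy
    have hkτ : k = τ j := hτu (hγU 0) (hk.mono (subset_insert (γ 0) (X j)))
    obtain ⟨T₀, hT₀, henv₀, hsafe₀⟩ := hk
    obtain ⟨w, hw0, hws, hwne, hwper⟩ := hwalk j
    have hch : ∀ l, ChampG v X (γ l) (w (l + 1)) (w l) := fun l => by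
      rw [hws]; exact hτ _ _ (hγU l)
    choose S hS henv hsafe using hch
    refine hX.no_improving_cycle (m := n) (by omega) w (by simpa using hwper 0)
      (fun s hs s' hs' hss => hwne s s' hss (by omega) (by omega)) ∅
      (fun s => if s = 0 then T₀ else S s) (fun s => if s = 0 then ∅ else {γ s})
      ?_ ?_ ?_ (by simp) ?_ ?_
    · intro s _
      rcases eq_or_ne s 0 with rfl | h
      · simpa [hw0] using hT₀
      · simpa only [h, if_false, sdiff_empty, union_comm, insert_eq] using hS s
    · intro s hs s' hs' hss
      rcases eq_or_ne s 0 with rfl | h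
      · simp
      · rcases eq_or_ne s' 0 with rfl | h'
        · simp
        · simpa [h, h'] using hγ' s s' hss (by omega) (by omega)
    · intro s _
      rcases eq_or_ne s 0 with rfl | h
      · simp
      · simpa [h] using hγU s
    · intro s _
      rcases eq_or_ne s 0 with rfl | h
      · have h1 : w (0 + 1) = k := by rw [hws, hw0, hkτ]
        rw [h1]
        exact henv₀
      · simpa [h] using henv s
    · intro s _
      rcases eq_or_ne s 0 with rfl | h
      · simpa using hsafe₀
      · simpa [h] using hsafe s
  -- Fix an agent `i` and an item `g`, and let `B` be the part of `X i` discarded by its champion.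
  obtain ⟨w, hw0, hws, hwne, hwper⟩ := hwalk ⟨0, by omega⟩
  set i : Fin n := ⟨0, by omega⟩
  set g : ι := γ n
  have hgU : g ∈ unalloc X := hγU n
  have hgX : ∀ k, g ∉ X k := fun k => disjoint_left.1 (disjoint_unalloc k) hgU
  have hch : ∀ l, ChampG v X (γ l) (w (l + 1)) (w l) := fun l => by
    rw [hws]; exact hτ _ _ (hγU l)
  have hwn : w n = i := by rw [← hw0]; simpa using hwper 0
  have hg_mem : ∀ {c j T}, T ⊆ insert g (X j) → EnviesSet v X c T → g ∈ T := by
    intro c j T hT hc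
    by_contra hgT
    have : T ⊆ X j := (subset_insert_iff_of_notMem hgT).1 hT
    exact absurd (((hval c).2.2 this).trans (hEF c j)) (not_le.2 hc)
  choose S hS henv hsafe using hch
  have hgT₀ : g ∈ S n := hg_mem (hS n) (henv n)
  let B : Finset ι := X i \ S n
  have hBX : B ⊆ X i := sdiff_subset
  have hgB : g ∉ B := fun h => hgX i (hBX h)
  have hBother : ∀ k, k ≠ i → Disjoint B (X k) := fun k hk =>
    (hX.alloc i k hk.symm).mono_left hBX
  let K : Fin n → Prop := fun k => v k {g} < v k B
  -- exchanging `g` for `B`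
  have hswap : ∀ k (R : Finset ι), g ∉ R → Disjoint R B → K k →
      v k (insert g R) < v k (R ∪ B) := by
    intro k R hgR hRB hk
    rw [insert_eq, union_comm R B]
    exact (hcan k).union_lt_union (hd k) (disjoint_singleton_left.2 hgR) hRB.symm hk
  have hswap' : ∀ k (R : Finset ι), g ∉ R → Disjoint R B →
      v k (insert g R) < v k (R ∪ B) → K k := by
    intro k R hgR hRB hk
    rw [insert_eq, union_comm R B] at hk
    exact (hcan k).lt_of_union_lt R (disjoint_singleton_left.2 hgR) hRB.symm hk
  have herase : (S n).erase g ∪ B = X i := by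
    have hsub : (S n).erase g ⊆ X i := by
      rw [← hwn]
      exact (subset_insert_iff).1 (hS n)
    ext x
    simp only [B, mem_union, mem_sdiff, mem_erase]
    constructor
    · rintro (h | h)
      · exact hsub (mem_erase.2 h)
      · exact h.1
    · intro h
      by_cases hx : x ∈ S n
      · exact Or.inl ⟨fun hxg => hgX i (hxg ▸ h), hx⟩
      · exact Or.inr ⟨h, hx⟩
  have hdisj : Disjoint ((S n).erase g) B :=
    (disjoint_sdiff_self_right).mono_left (erase_subset _ _)
  have hKi : K i := by
    refine hswap' i ((S n).erase g) (notMem_erase _ _) hdisj ?_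
    rw [insert_erase hgT₀, herase]
    refine lt_of_le_of_ne (not_lt.1 fun hlt => ?_) (hd i _ _ fun h => hgX i (h ▸ hgT₀))
    have hii : i = τ i := by
      refine hτu hgU ⟨S n, ?_, hlt, hsafe n⟩
      simpa [hwn] using hS n
    refine hwne 0 1 (by omega) (by omega) (by omega) ?_
    rw [hws 0, hw0]
    exact hii
  have hK1 : ¬ K (w 1) := by
    intro hk
    have h1 := hswap (w 1) ((S n).erase g) (notMem_erase _ _) hdisj hk
    rw [insert_erase hgT₀, herase] at h1
    have h2 := henv n
    have h3 : w (n + 1) = w 1 := by rw [add_comm]; exact hwper 1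
    rw [h3] at h2
    exact absurd (h1.le.trans (hEF (w 1) i)) (not_le.2 h2)
  -- the first agent after `i` along the walk that prefers `B` to `g`
  have hexl : ∃ l, 1 ≤ l ∧ K (w l) := ⟨n, by omega, by rwa [hwn]⟩
  classical
  obtain ⟨l, ⟨hl1, hKl⟩, hlmin⟩ : ∃ l, (1 ≤ l ∧ K (w l)) ∧
      ∀ t, 1 ≤ t → K (w t) → l ≤ t :=
    ⟨Nat.find hexl, Nat.find_spec hexl, fun t h1 h2 => Nat.find_min' hexl ⟨h1, h2⟩⟩
  have hln : l ≤ n := hlmin n (by omega) (by rwa [hwn])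
  have hl2 : 2 ≤ l := by
    by_contra h
    obtain rfl : l = 1 := by omega
    exact hK1 hKl
  have hli : w (l - 1) ≠ i := by
    rw [← hwn]
    exact hwne _ _ (by omega) (by omega) (by omega)
  have hwl : τ (w (l - 1)) = w l := by rw [← hws, Nat.sub_add_cancel hl1]
  obtain ⟨T, hT, henvT, hsafeT⟩ := hτ (w (l - 1)) g hgU
  have hgT : g ∈ T := hg_mem hT henvT
  rw [hwl] at henvT
  have hTsub : T.erase g ⊆ X (w (l - 1)) := subset_insert_iff.1 hT
  have hTB : Disjoint (T.erase g) B := ((hBother _ hli).mono_right hTsub).symm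
  have hlenv : EnviesSet v X (w l) (T.erase g ∪ B) := by
    have := hswap (w l) (T.erase g) (notMem_erase _ _) hTB hKl
    rw [insert_erase hgT] at this
    exact henvT.trans this
  obtain ⟨k, T', hT', henv', hsafe'⟩ := exists_mostEnvious hlenv
  have hkK : K k := by
    by_cases hkl : k = w l
    · rwa [hkl]
    · refine hswap' k (T.erase g) (notMem_erase _ _) hTB ?_
      rw [insert_erase hgT]
      have h1 : v k T ≤ v k (X k) := by
        by_contra! hlt
        exact hkl ((hτu hgU ⟨T, hT, hlt, hsafeT⟩).trans hwl)
      exact h1.trans_lt (lt_of_lt_of_le henv' ((hval k).2.2 hT'))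
  obtain ⟨t, ht1, htn, hkt⟩ : ∃ t, 1 ≤ t ∧ t ≤ n ∧ w t = k := by
    have hinj : Function.Injective fun s : Fin n => w (1 + s) := by
      intro a b hab
      by_contra hne
      exact hwne _ _ (fun h => hne (Fin.ext (Nat.add_left_cancel h))) (by omega) (by omega) hab
    obtain ⟨s, hs⟩ := (Finite.injective_iff_surjective.1 hinj) k
    exact ⟨1 + s, by omega, by omega, hs⟩
  have hlt : l ≤ t := hlmin t ht1 (by rwa [hkt])
  -- the improving cycle `w (l - 1), w t, w (t + 1), …, w (n + l - 1)`
  let r : ℕ → ℕ := fun s => if s = 0 then l - 1 else t + s - 1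
  have hr0 : r 0 = l - 1 := rfl
  have hrs : ∀ s, s ≠ 0 → r s = t + s - 1 := fun s hs => if_neg hs
  have hi : ∀ s < n + l - t, w (r s) = i → r s = n := by
    intro s hs hwi
    by_contra hne
    rw [← hwn] at hwi
    rcases eq_or_ne s 0 with rfl | h
    · exact hwne _ _ hne (by omega) (by omega) hwi
    · have := hrs s h
      exact hwne _ _ hne (by omega) (by omega) hwi
  refine hX.no_improving_cycle (m := n + l - t) (by omega) (fun s => w (r s)) ?_ ?_ B
    (fun s => if s = 0 then T' else S (r s)) (fun s => if s = 0 then B else {γ (r s)})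
    ?_ ?_ ?_ ?_ ?_ ?_
  · rw [hr0, hrs _ (by omega), ← hwper (l - 1)]
    congr 1
    omega
  · intro s hs s' hs' hss
    rcases eq_or_ne s 0 with rfl | h <;> rcases eq_or_ne s' 0 with rfl | h'
    · exact absurd rfl hss
    · have := hrs s' h'
      exact hwne _ _ (by omega) (by omega) (by omega)
    · have := hrs s h
      exact hwne _ _ (by omega) (by omega) (by omega)
    · have := hrs s h
      have := hrs s' h'
      exact hwne _ _ (by omega) (by omega) (by omega)
  · intro s hs
    rcases eq_or_ne s 0 with rfl | h
    · simp only [if_true, hr0]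
      rw [sdiff_eq_self_of_disjoint (hBother _ hli).symm]
      exact hT'.trans (union_subset_union_left hTsub)
    · simp only [h, if_false]
      intro x hx
      have hx' := hS (r s) hx
      rw [mem_insert] at hx'
      rw [mem_union, mem_sdiff, mem_singleton]
      rcases hx' with hx' | hx'
      · exact Or.inr hx'
      · refine Or.inl ⟨hx', fun hxB => ?_⟩
        by_cases hwi : w (r s) = i
        · rw [hi s hs hwi] at hx
          exact (mem_sdiff.1 hxB).2 hx
        · exact disjoint_left.1 (hBother _ hwi) hxB hx'
  · have hγB : ∀ s, γ s ∉ B := fun s h =>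
      disjoint_left.1 (disjoint_unalloc i) (hγU s) (hBX h)
    intro s hs s' hs' hss
    rcases eq_or_ne s 0 with rfl | h <;> rcases eq_or_ne s' 0 with rfl | h'
    · exact absurd rfl hss
    · simpa [h'] using hγB _
    · simpa [h] using hγB _
    · have h1 := hrs s h
      have h2 := hrs s' h'
      simpa [h, h'] using hγ' (r s) (r s') (by omega) (by omega) (by omega)
  · intro s _
    rcases eq_or_ne s 0 with rfl | h
    · simp
    · simpa [h] using Or.inl (hγU (r s))
  · intro k hk
    refine hBother k ?_
    rintro rfl
    refine hk (n + 1 - t) (by omega) ?_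
    rw [hrs _ (by omega), ← hwn]
    congr 1
    omega
  · intro s _
    rcases eq_or_ne s 0 with rfl | h
    · simpa [hrs 1, hkt] using henv'
    · have : r (s + 1) = r s + 1 := by
        rw [hrs s h, hrs (s + 1) (by omega)]
        omega
      simpa [h, this] using henv (r s)
  · intro s _
    rcases eq_or_ne s 0 with rfl | h
    · simpa using hsafe'
    · simpa [h] using hsafe (r s)

end Champions

/-- For every setting with `n` agents whose valuations are nice
cancelable, there exists a partial EFX allocation with at most `n - 2` unallocated
items, in which moreover no agent envies the set of unallocated items. -/
theorem efx_at_most_n_sub_two_unallocated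
    {ι : Type*} [DecidableEq ι] [Fintype ι] {n : ℕ} (hn : 0 < n)
    (v : Fin n → Finset ι → ℝ)
    (hval : ∀ i, IsValuation (v i)) (hnice : ∀ i, NiceCancelable (v i)) :
    ∃ X : Fin n → Finset ι, IsPartialAlloc X ∧ IsEFX v X ∧
      (unalloc X).card ≤ n - 2 ∧ ∀ i : Fin n, ¬ EnviesSet v X i (unalloc X) := by
  obtain rfl | hn2 : n = 1 ∨ 2 ≤ n := by omega
  · refine ⟨fun _ => univ, fun i j h => absurd (Subsingleton.elim i j) h,
      fun i j h => absurd (Subsingleton.elim i j) h, by simp [unalloc], fun i => ?_⟩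
    exact not_lt.2 ((hval i).2.2 (subset_univ _))
  choose _ v' hval' hd hcan hresp using hnice
  obtain ⟨X, hE, hX⟩ := exists_isUnimprovable v' hval'
  refine ⟨X, hX.alloc, ?_, ?_, ?_⟩
  · rintro i j hij ⟨a, ha, hlt⟩
    exact hE i j hij ⟨a, ha, hresp i _ _ hlt⟩
  · have := hX.card_unalloc_lt hn2 hval' hd hcan
    omega
  · exact fun i h => hX.not_enviesSet_unalloc i (hresp i _ _ h)

end FairDivision
end

section
/- Every setting with 3 agents whose valuations are nice cancelable (this includes all additive valuations, and also budget-additive, unit-demand and multiplicative valuations, possibly of different classes for different agents) admits a complete EFX allocation. -/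
namespace FairDivision

open Finset

lemma strictMono_of_monotone_nonDegenerate {ι : Type*} {u : Finset ι → ℝ} (hu : Monotone u)
    (hn : NonDegenerate u) : StrictMono u :=
  hu.strictMono_of_injective fun S T h => by_contra fun hne => hn S T hne h

section ThreeAgents

variable {ι : Type*} [DecidableEq ι]

/-- With valuation `u`, the owner of `S` does not strongly envy `T`. -/
def Feasible (u : Finset ι → ℝ) (S T : Finset ι) : Prop :=
  ∀ h ∈ T, u (T.erase h) ≤ u S

lemma feasible_of_le {u : Finset ι → ℝ} (hu : Monotone u) {S T : Finset ι} (h : u T ≤ u S) :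
    Feasible u S T :=
  fun _ _ => (hu (erase_subset _ _)).trans h

lemma Feasible.mono {u : Finset ι → ℝ} (hu : Monotone u) {S S' T T' : Finset ι}
    (h : Feasible u S T) (hS : u S ≤ u S') (hT : T' ⊆ T) : Feasible u S' T' :=
  fun k hk => (hu (erase_subset_erase _ hT)).trans ((h k (hT hk)).trans hS)

/-- Cancelability extends from single items to disjoint sets of items. -/
lemma Cancelable.of_union {u : Finset ι → ℝ} (hc : Cancelable u) {S T : Finset ι} (R : Finset ι)
    (hS : Disjoint S R) (hT : Disjoint T R) (h : u (T ∪ R) < u (S ∪ R)) : u T < u S := by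
  induction R using Finset.induction_on with
  | empty => simpa using h
  | insert g R hg ih =>
    simp only [disjoint_insert_right] at hS hT
    refine ih hS.2 hT.2 (hc _ _ g ?_ ?_ ?_)
    · simp [hS.1, hg]
    · simp [hT.1, hg]
    · simpa only [union_insert] using h

/-- Cancelable valuations are MMS-feasible. -/
lemma Cancelable.mms_feasible {u : Finset ι → ℝ} (hc : Cancelable u) {A₁ A₂ B₁ B₂ : Finset ι}
    (hA : Disjoint A₁ A₂) (hB : Disjoint B₁ B₂) (h : A₁ ∪ A₂ = B₁ ∪ B₂) :
    min (u A₁) (u A₂) ≤ max (u B₁) (u B₂) := by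
  by_contra! hlt
  obtain ⟨h1, h2⟩ := max_lt_iff.1 hlt
  have h1 := (lt_min_iff.1 h1).1
  have h2 := (lt_min_iff.1 h2).2
  have hm (x : ι) : x ∈ A₁ ∨ x ∈ A₂ ↔ x ∈ B₁ ∨ x ∈ B₂ := by simp only [← mem_union, h]
  have key1 : u (B₁ ∩ A₂) < u (A₁ ∩ B₂) := by
    refine hc.of_union (A₁ ∩ B₁) (by grind [Finset.disjoint_left])
      (by grind [Finset.disjoint_left]) ?_
    rwa [show B₁ ∩ A₂ ∪ A₁ ∩ B₁ = B₁ by grind, show A₁ ∩ B₂ ∪ A₁ ∩ B₁ = A₁ by grind]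
  have key2 : u (A₁ ∩ B₂) < u (B₁ ∩ A₂) := by
    refine hc.of_union (A₂ ∩ B₂) (by grind [Finset.disjoint_left])
      (by grind [Finset.disjoint_left]) ?_
    rwa [show A₁ ∩ B₂ ∪ A₂ ∩ B₂ = B₂ by grind, show B₁ ∩ A₂ ∪ A₂ ∩ B₂ = A₂ by grind]
  exact lt_asymm key1 key2

/-- Moving items one at a time towards the poorer bundle ends in a partition into two bundles,
neither of which is strongly envied from the other. -/
lemma exists_feasible_pair {u : Finset ι → ℝ} (hu : StrictMono u) {A B : Finset ι}
    (hAB : Disjoint A B) : ∃ P Q : Finset ι, Disjoint P Q ∧ P ∪ Q = A ∪ B ∧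
      Feasible u P Q ∧ Feasible u Q P ∧ min (u A) (u B) ≤ min (u P) (u Q) := by
  obtain ⟨P, hP, hmax⟩ := (A ∪ B).powerset.exists_max_image (fun P => min (u P) (u ((A ∪ B) \ P)))
    ⟨∅, empty_mem_powerset _⟩
  have main : ∀ P Q : Finset ι, Disjoint P Q → P ∪ Q = A ∪ B →
      (∀ R ⊆ A ∪ B, min (u R) (u ((A ∪ B) \ R)) ≤ min (u P) (u Q)) → Feasible u P Q := by
    intro P Q hd hPQ hm h hh
    by_contra! hlt
    have h1 := hm (insert h P)
      (insert_subset (hPQ ▸ mem_union_right _ hh) (hPQ ▸ subset_union_left))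
    have h2 : (A ∪ B) \ insert h P = Q.erase h := by
      rw [← hPQ, sdiff_insert, union_sdiff_cancel_left hd]
    rw [h2] at h1
    have h3 : u P < u (insert h P) := hu (ssubset_insert (disjoint_right.1 hd hh))
    exact absurd (h1.trans (min_le_left _ _)) (not_le.2 (lt_min h3 hlt))
  have hP' : P ⊆ A ∪ B := mem_powerset.1 hP
  have hm : ∀ R ⊆ A ∪ B, min (u R) (u ((A ∪ B) \ R)) ≤ min (u P) (u ((A ∪ B) \ P)) :=
    fun R hR => hmax R (mem_powerset.2 hR)
  refine ⟨P, (A ∪ B) \ P, disjoint_sdiff, union_sdiff_of_subset hP',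
    main _ _ disjoint_sdiff (union_sdiff_of_subset hP') hm,
    main _ _ sdiff_disjoint (by rw [sdiff_union_of_subset hP']) fun R hR => ?_, ?_⟩
  · rw [min_comm (u (_ \ P))]; exact hm R hR
  · have h := hm A subset_union_left
    rwa [union_sdiff_cancel_left hAB] at h

/-- The owner of `A` strongly envies neither `B` nor `C`. -/
def Feasible₂ (u : Finset ι → ℝ) (A B C : Finset ι) : Prop :=
  Feasible u A B ∧ Feasible u A C

lemma feasible_of_card_le_one {u : Finset ι → ℝ} (hu : Monotone u) (S : Finset ι)
    {T : Finset ι} (hT : T.card ≤ 1) : Feasible u S T := by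
  intro h hh
  have : T.erase h = ∅ := by
    rw [← card_eq_zero, card_erase_of_mem hh]; omega
  rw [this]
  exact hu (empty_subset S)

/-- An agent accepting neither `A` nor `B` values `C` minus some item more than either. -/
lemma exists_erase_lt {u : Finset ι → ℝ} (hu : Monotone u) {A B C : Finset ι}
    (hA : ¬ Feasible₂ u A B C) (hB : ¬ Feasible₂ u B A C) :
    ∃ g ∈ C, u A < u (C.erase g) ∧ u B < u (C.erase g) := by
  rcases le_total (u A) (u B) with h | h
  · have h1 : ¬ Feasible u B C := fun h' => hB ⟨feasible_of_le hu h, h'⟩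
    simp only [Feasible, not_forall, not_le] at h1
    obtain ⟨g, hg, hlt⟩ := h1
    exact ⟨g, hg, h.trans_lt hlt, hlt⟩
  · have h1 : ¬ Feasible u A C := fun h' => hA ⟨feasible_of_le hu h, h'⟩
    simp only [Feasible, not_forall, not_le] at h1
    obtain ⟨g, hg, hlt⟩ := h1
    exact ⟨g, hg, hlt, h.trans_lt hlt⟩

variable [Fintype ι]

/-- The three bundles partition the set of all items. -/
structure IsPartition (A B C : Finset ι) : Prop where
  disjoint_left : Disjoint A B
  disjoint_outer : Disjoint A C
  disjoint_right : Disjoint B C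
  union_eq : A ∪ B ∪ C = univ

lemma IsPartition.swap {A B C : Finset ι} (h : IsPartition A B C) : IsPartition B A C :=
  ⟨h.1.symm, h.3, h.2, by rw [union_comm B A]; exact h.4⟩

lemma IsPartition.rotate {A B C : Finset ι} (h : IsPartition A B C) : IsPartition B C A :=
  ⟨h.3, h.1.symm, h.2.symm, by rw [← h.4]; grind⟩

/-- A complete EFX allocation for three agents with valuations `a`, `b`, `c`. -/
def ExistsEFX (a b c : Finset ι → ℝ) : Prop :=
  ∃ A B C : Finset ι, IsPartition A B C ∧ Feasible₂ a A B C ∧ Feasible₂ b B A C ∧ Feasible₂ c C A B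

/-- A partition in which the first agent accepts `A` and `B`, both worth more than `t` to it,
and one of the other two agents accepts `C`. -/
structure IsGood (a b c : Finset ι → ℝ) (t : ℝ) (A B C : Finset ι) : Prop where
  part : IsPartition A B C
  lt_left : t < a A
  lt_right : t < a B
  feasible_left : Feasible₂ a A B C
  feasible_right : Feasible₂ a B A C
  feasible_other : Feasible₂ b C A B ∨ Feasible₂ c C A B

lemma IsGood.swap {a b c : Finset ι → ℝ} {t : ℝ} {A B C : Finset ι} (h : IsGood a b c t A B C) :
    IsGood a b c t B A C :=
  ⟨h.part.swap, h.3, h.2, h.5, h.4, h.6.imp And.symm And.symm⟩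

/-- Among partitions maximizing the least value, no bundle is strongly envied. -/
lemma exists_feasible_triple {u : Finset ι → ℝ} (hu : StrictMono u) (hn : NonDegenerate u)
    (h0 : u ∅ = 0) {t : ℝ} (ht : 0 ≤ t) {P Q R : Finset ι} (hp : IsPartition P Q R)
    (hP : t < u P) (hQ : t < u Q) (hR : t < u R) :
    ∃ A B C : Finset ι, IsPartition A B C ∧ t < u A ∧ t < u B ∧ t < u C ∧
      Feasible₂ u A B C ∧ Feasible₂ u B A C ∧ Feasible₂ u C A B := by
  let m (A B C : Finset ι) : ℝ := min (u A) (min (u B) (u C))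
  have hswap (A B C : Finset ι) : m B A C = m A B C := min_left_comm _ _ _
  have hrot (A B C : Finset ι) : m B C A = m A B C := by
    simp only [m]; rw [← min_assoc, min_comm]
  obtain ⟨⟨A, B, C⟩, hA, hmax⟩ := Set.exists_max_image
    {x : Finset ι × Finset ι × Finset ι | IsPartition x.1 x.2.1 x.2.2}
    (fun x => m x.1 x.2.1 x.2.2) (Set.toFinite _) ⟨(P, Q, R), hp⟩
  replace hA : IsPartition A B C := hA
  replace hmax : ∀ X Y Z, IsPartition X Y Z → m X Y Z ≤ m A B C :=
    fun X Y Z h => hmax (X, Y, Z) h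
  have hlt : t < m A B C := (lt_min hP (lt_min hQ hR)).trans_le (hmax _ _ _ hp)
  have main : ∀ X Y Z : Finset ι, IsPartition X Y Z → m X Y Z = m A B C → Feasible u X Y := by
    intro X Y Z hd hm h hh
    by_contra! hXY
    rw [← hm] at hlt hmax
    simp only [m, lt_min_iff] at hlt
    have hhX : h ∉ X := disjoint_right.1 hd.1 hh
    have hhZ : h ∉ Z := disjoint_left.1 hd.3 hh
    have hX : u X < u (insert h X) := hu (ssubset_insert hhX)
    have hZ : u Z < u (insert h Z) := hu (ssubset_insert hhZ)
    have hne : u X ≠ u Z := by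
      refine hn _ _ fun h' => ?_
      have h1 := hd.2
      rw [← h', disjoint_self] at h1
      rw [h1] at hlt
      exact absurd hlt.1 (by rw [bot_eq_empty, h0]; exact not_lt.2 ht)
    obtain ⟨d1, d2, d3, d4⟩ := hd
    rcases lt_or_gt_of_ne hne with hlt' | hlt'
    · have h1 := hmax (insert h X) (Y.erase h) Z
        ⟨by grind [Finset.disjoint_left], by grind [Finset.disjoint_left],
          by grind [Finset.disjoint_left], by rw [← d4]; grind⟩
      exact absurd (h1.trans (min_le_left _ _)) (not_le.2 (lt_min hX (lt_min hXY hlt')))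
    · have h1 := hmax X (Y.erase h) (insert h Z)
        ⟨by grind [Finset.disjoint_left], by grind [Finset.disjoint_left],
          by grind [Finset.disjoint_left], by rw [← d4]; grind⟩
      exact absurd (h1.trans ((min_le_right _ _).trans (min_le_right _ _)))
        (not_le.2 (lt_min hlt' (lt_min (hlt'.trans hXY) hZ)))
  have hpos := hlt
  simp only [m, lt_min_iff] at hpos
  refine ⟨A, B, C, hA, hpos.1, hpos.2.1, hpos.2.2, ⟨main _ _ _ hA rfl, ?_⟩,
    ⟨main _ _ _ hA.swap (hswap _ _ _), main _ _ _ hA.rotate (hrot _ _ _)⟩,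
    ⟨main _ _ _ hA.rotate.rotate (by rw [hrot, hrot]), ?_⟩⟩
  · exact main _ _ _ hA.rotate.rotate.swap (by rw [hswap, hrot, hrot])
  · exact main _ _ _ hA.rotate.swap (by rw [hswap, hrot])

/-- If all three bundles are worth more than `t` to the first agent, a good partition exists. -/
lemma exists_isGood {a b : Finset ι → ℝ} (c : Finset ι → ℝ) (ha : StrictMono a)
    (hn : NonDegenerate a) (h0 : a ∅ = 0) (hb : Monotone b) {t : ℝ} (ht : 0 ≤ t)
    {P Q R : Finset ι} (hp : IsPartition P Q R) (hP : t < a P) (hQ : t < a Q) (hR : t < a R) :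
    ∃ A B C : Finset ι, IsGood a b c t A B C := by
  obtain ⟨A, B, C, hd, hA, hB, hC, fA, fB, fC⟩ := exists_feasible_triple ha hn h0 ht hp hP hQ hR
  by_cases h1 : b A ≤ b C ∧ b B ≤ b C
  · exact ⟨A, B, C, hd, hA, hB, fA, fB,
      .inl ⟨feasible_of_le hb h1.1, feasible_of_le hb h1.2⟩⟩
  by_cases h2 : b B ≤ b A ∧ b C ≤ b A
  · exact ⟨B, C, A, hd.rotate, hB, hC, fB.symm, fC.symm,
      .inl ⟨feasible_of_le hb h2.1, feasible_of_le hb h2.2⟩⟩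
  have h3 : b C ≤ b B ∧ b A ≤ b B := by grind
  exact ⟨C, A, B, hd.rotate.rotate, hC, hA, fC, fA.symm,
    .inl ⟨feasible_of_le hb h3.1, feasible_of_le hb h3.2⟩⟩

lemma IsGood.swap_others {a b c : Finset ι → ℝ} {t : ℝ} {A B C : Finset ι}
    (h : IsGood a b c t A B C) : IsGood a c b t A B C :=
  ⟨h.1, h.2, h.3, h.4, h.5, h.6.symm⟩

/-- If the first agent strongly envies `Q` when owning `P`, and the second agent accepts `R`, then
shrinking `Q` and moving the excess to `R` yields a good partition. -/
lemma exists_isGood_of_not_feasible {a b : Finset ι → ℝ} (c : Finset ι → ℝ) (ha : StrictMono a)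
    (hn : NonDegenerate a) (h0 : a ∅ = 0) (hb : Monotone b) {t : ℝ} (ht : 0 ≤ t)
    {P Q R : Finset ι} (hp : IsPartition P Q R) (hP : t < a P) (hPQ : ¬ Feasible a P Q)
    (hR : Feasible₂ b R P Q) : ∃ A B C : Finset ι, IsGood a b c t A B C := by
  simp only [Feasible, not_forall, not_le] at hPQ
  obtain ⟨h, hh, hlt⟩ := hPQ
  obtain ⟨Z, hZ, hmin⟩ := ((Q.erase h).powerset.filter fun Z => a P < a Z).exists_minimal
    ⟨Q.erase h, by simp [hlt]⟩
  simp only [mem_filter, mem_powerset] at hZ hmin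
  obtain ⟨hZQ, hPZ⟩ := hZ
  have hd : IsPartition P Z (R ∪ (Q \ Z)) := by
    obtain ⟨d1, d2, d3, d4⟩ := hp
    exact ⟨by grind [Finset.disjoint_left], by grind [Finset.disjoint_left],
      by grind [Finset.disjoint_left], by rw [← d4]; grind⟩
  by_cases hW : Feasible a P (R ∪ (Q \ Z))
  · refine ⟨P, Z, _, hd, hP, hP.trans hPZ, ⟨?_, hW⟩,
      ⟨feasible_of_le ha.monotone hPZ.le, hW.mono ha.monotone hPZ.le subset_rfl⟩, .inl ⟨?_, ?_⟩⟩
    · intro k hk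
      by_contra! hlt'
      have := hmin (y := Z.erase k) ⟨(erase_subset _ _).trans hZQ, hlt'⟩ (erase_subset _ _)
      exact notMem_erase k Z (this hk)
    · exact hR.1.mono hb (hb subset_union_left) subset_rfl
    · refine hR.2.mono hb (hb subset_union_left) (hZQ.trans (erase_subset _ _))
  · simp only [Feasible, not_forall, not_le] at hW
    obtain ⟨k, hk, hlt'⟩ := hW
    exact exists_isGood c ha hn h0 hb ht hd hP (hP.trans hPZ)
      ((hP.trans hlt').trans (ha (erase_ssubset hk)))

/-- If `b` still prefers `C` after giving one of its items to `A`, a better good partition exists. -/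
lemma IsGood.exists_of_lt {a b c : Finset ι → ℝ} (ha : StrictMono a) (hn : NonDegenerate a)
    (h0 : a ∅ = 0) (hb : Monotone b) {t : ℝ} (ht : 0 ≤ t) {A B C : Finset ι}
    (h : IsGood a b c t A B C) (hAB : a A < a B) {g : ι} (hg : g ∈ C)
    (hB : b B < b (C.erase g)) (hlt : b (insert g A) < b (C.erase g)) :
    ∃ A' B' C' : Finset ι, IsGood a b c (a A) A' B' C' := by
  have hgA : g ∉ A := disjoint_right.1 h.part.2 hg
  have hA : a A < a (insert g A) := ha (ssubset_insert hgA)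
  have hd : IsPartition B (insert g A) (C.erase g) := by
    obtain ⟨d1, d2, d3, d4⟩ := h.part
    exact ⟨by grind [Finset.disjoint_left], by grind [Finset.disjoint_left],
      by grind [Finset.disjoint_left], by rw [← d4]; grind⟩
  have hC : Feasible₂ b (C.erase g) B (insert g A) :=
    ⟨feasible_of_le hb hB.le, feasible_of_le hb hlt.le⟩
  by_cases hf : Feasible a B (insert g A)
  · exact ⟨B, insert g A, C.erase g, hd, hAB, hA,
      ⟨hf, h.feasible_right.2.mono ha.monotone le_rfl (erase_subset _ _)⟩,
      ⟨h.feasible_left.1.mono ha.monotone hA.le subset_rfl,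
        h.feasible_left.2.mono ha.monotone hA.le (erase_subset _ _)⟩, .inl hC⟩
  · exact exists_isGood_of_not_feasible c ha hn h0 hb (ht.trans h.lt_left.le) hd hAB hf hC

lemma IsGood.existsEFX_or_exists_of_lt {a b c : Finset ι → ℝ} (ha : StrictMono a)
    (hn : NonDegenerate a) (h0 : a ∅ = 0) (hb : StrictMono b) (hc : Monotone c)
    (hcc : Cancelable c) {t : ℝ} (ht : 0 ≤ t) {A B C : Finset ι}
    (h : IsGood a b c t A B C) (hAB : a A < a B) :
    ExistsEFX a b c ∨ ∃ A' B' C' : Finset ι, IsGood a b c (a A) A' B' C' := by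
  by_contra! ⟨hE, hG⟩
  have hnot : ¬ ∃ A' B' C', IsGood a b c (a A) A' B' C' := fun ⟨A', B', C', h'⟩ => hG A' B' C' h'
  have hp := h.part
  have key : (¬ Feasible₂ b A B C ∧ ¬ Feasible₂ b B A C) ∧
      (¬ Feasible₂ c A B C ∧ ¬ Feasible₂ c B A C) := by
    have hb' : Feasible₂ c C A B → ¬ Feasible₂ b A B C ∧ ¬ Feasible₂ b B A C := fun hC =>
      ⟨fun h' => hE ⟨B, A, C, hp.swap, h.feasible_right, h', hC.symm⟩,
        fun h' => hE ⟨A, B, C, hp, h.feasible_left, h', hC⟩⟩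
    have hc' : Feasible₂ b C A B → ¬ Feasible₂ c A B C ∧ ¬ Feasible₂ c B A C := fun hC =>
      ⟨fun h' => hE ⟨B, C, A, hp.rotate, h.feasible_right.symm, hC.symm, h'⟩,
        fun h' => hE ⟨A, C, B, hp.rotate.rotate.swap, h.feasible_left.symm, hC, h'⟩⟩
    have accept : ∀ u : Finset ι → ℝ, Monotone u → ¬ Feasible₂ u A B C ∧ ¬ Feasible₂ u B A C →
        Feasible₂ u C A B := by
      intro u hu ⟨h1, h2⟩
      obtain ⟨g, -, h3, h4⟩ := exists_erase_lt hu h1 h2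
      have h5 := hu (erase_subset g C)
      exact ⟨feasible_of_le hu (h3.le.trans h5), feasible_of_le hu (h4.le.trans h5)⟩
    rcases h.feasible_other with hC | hC
    · exact ⟨hb' (accept c hc (hc' hC)), hc' hC⟩
    · exact ⟨hb' hC, hc' (accept b hb.monotone (hb' hC))⟩
  obtain ⟨g, hg, -, hgB⟩ := exists_erase_lt hb.monotone key.1.1 key.1.2
  obtain ⟨k, hk, -, hkB⟩ := exists_erase_lt hc key.2.1 key.2.2
  have hg' : b (C.erase g) ≤ b (insert g A) := by
    by_contra! hlt
    exact hnot (h.exists_of_lt ha hn h0 hb.monotone ht hAB hg hgB hlt)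
  have hk' : c (C.erase k) ≤ c (insert k A) := by
    by_contra! hlt
    obtain ⟨A', B', C', h'⟩ := h.swap_others.exists_of_lt ha hn h0 hc ht hAB hk hkB hlt
    exact hG A' B' C' h'.swap_others
  have split : ∀ x ∈ C, Disjoint (insert x A) (C.erase x) ∧ insert x A ∪ C.erase x = A ∪ C := by
    intro x hx
    have := hp.2
    exact ⟨by grind [Finset.disjoint_left], by grind⟩
  obtain ⟨P, Q, hPQ, hun, fP, fQ, hmin⟩ := exists_feasible_pair hb (split g hg).1
  rw [(split g hg).2] at hun
  obtain ⟨hBP, hBQ⟩ := lt_min_iff.1 ((lt_min (hgB.trans_le hg') hgB).trans_le hmin)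
  have hmms := hcc.mms_feasible (split k hk).1 hPQ ((split k hk).2.trans hun.symm)
  have hcB : c B < max (c P) (c Q) := (lt_min (hkB.trans_le hk') hkB).trans_le hmms
  have finish : ∀ P Q : Finset ι, Disjoint P Q → P ∪ Q = A ∪ C → Feasible b P Q →
      Feasible b Q P → b B < b P → b B < b Q → c Q ≤ c P → c B < c P → False := by
    intro P Q hPQ hun fP fQ hBP hBQ hcQ hcB
    have hd : IsPartition B P Q := by
      obtain ⟨d1, d2, d3, d4⟩ := hp
      have hB : Disjoint B (P ∪ Q) := by rw [hun]; exact disjoint_union_right.2 ⟨d1.symm, d3⟩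
      rw [disjoint_union_right] at hB
      exact ⟨hB.1, hB.2, hPQ, by rw [union_assoc, hun, ← d4]; grind⟩
    have fBP : Feasible a B P := by
      by_contra hf
      exact hnot (exists_isGood_of_not_feasible c ha hn h0 hb.monotone (ht.trans h.lt_left.le)
        hd hAB hf ⟨feasible_of_le hb.monotone hBQ.le, fQ⟩)
    have fBQ : Feasible a B Q := by
      by_contra hf
      exact hnot (exists_isGood_of_not_feasible c ha hn h0 hb.monotone (ht.trans h.lt_left.le)
        hd.rotate.rotate.swap
        hAB hf ⟨feasible_of_le hb.monotone hBP.le, fP⟩)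
    exact hE ⟨B, Q, P, hd.rotate.rotate.swap, ⟨fBQ, fBP⟩,
      ⟨feasible_of_le hb.monotone hBQ.le, fQ⟩,
      ⟨feasible_of_le hc hcB.le, feasible_of_le hc hcQ⟩⟩
  rcases le_total (c Q) (c P) with hle | hle
  · exact finish P Q hPQ hun fP fQ hBP hBQ hle (by rwa [max_eq_left hle] at hcB)
  · exact finish Q P hPQ.symm (by rw [union_comm, hun]) fQ fP hBQ hBP hle
      (by rwa [max_eq_right hle] at hcB)

lemma IsGood.existsEFX_or_exists {a b c : Finset ι → ℝ} (ha : StrictMono a)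
    (hn : NonDegenerate a) (h0 : a ∅ = 0) (hb : StrictMono b) (hc : Monotone c)
    (hcc : Cancelable c) {A B C : Finset ι} (h : IsGood a b c 0 A B C) :
    ExistsEFX a b c ∨ ∃ A' B' C' : Finset ι, IsGood a b c (min (a A) (a B)) A' B' C' := by
  have hne : a A ≠ a B := by
    refine hn _ _ fun hAB => ?_
    have h1 := h.part.1
    rw [← hAB, disjoint_self] at h1
    have h2 := h.lt_left
    rw [h1, bot_eq_empty, h0] at h2
    exact lt_irrefl _ h2
  rcases lt_or_gt_of_ne hne with hlt | hlt
  · rw [min_eq_left hlt.le]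
    exact h.existsEFX_or_exists_of_lt ha hn h0 hb hc hcc le_rfl hlt
  · rw [min_eq_right hlt.le]
    exact h.swap.existsEFX_or_exists_of_lt ha hn h0 hb hc hcc le_rfl hlt

/-- A good partition of largest potential shows that an EFX allocation exists. -/
lemma IsGood.existsEFX {a b c : Finset ι → ℝ} (ha : StrictMono a)
    (hn : NonDegenerate a) (h0 : a ∅ = 0) (hb : StrictMono b) (hc : Monotone c)
    (hcc : Cancelable c) {A B C : Finset ι} (h : IsGood a b c 0 A B C) : ExistsEFX a b c := by
  obtain ⟨⟨X, Y, Z⟩, hX, hmax⟩ := Set.exists_max_image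
    {x : Finset ι × Finset ι × Finset ι | IsGood a b c 0 x.1 x.2.1 x.2.2}
    (fun x => min (a x.1) (a x.2.1)) (Set.toFinite _) ⟨(A, B, C), h⟩
  replace hX : IsGood a b c 0 X Y Z := hX
  refine (hX.existsEFX_or_exists ha hn h0 hb hc hcc).resolve_right ?_
  rintro ⟨A', B', C', h'⟩
  have h1 := hmax (A', B', C') ⟨h'.1, (lt_min hX.2 hX.3).trans h'.2,
    (lt_min hX.2 hX.3).trans h'.3, h'.4, h'.5, h'.6⟩
  exact absurd h1 (not_le.2 (lt_min h'.2 h'.3))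

lemma existsEFX_of_card_le_one {a b c : Finset ι → ℝ} (ha : Monotone a) (hb : Monotone b)
    (hc : Monotone c) {A B C : Finset ι} (hp : IsPartition A B C) (hA : A.card ≤ 1)
    (hB : B.card ≤ 1) (hC : C.card ≤ 1) : ExistsEFX a b c :=
  ⟨A, B, C, hp,
    ⟨feasible_of_card_le_one ha _ hB, feasible_of_card_le_one ha _ hC⟩,
    ⟨feasible_of_card_le_one hb _ hA, feasible_of_card_le_one hb _ hC⟩,
    ⟨feasible_of_card_le_one hc _ hA, feasible_of_card_le_one hc _ hB⟩⟩

/-- Two agents may have arbitrary non-degenerate valuations if the third one is cancelable. -/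
lemma existsEFX_of_cancelable {a b c : Finset ι → ℝ} (ha : StrictMono a) (hn : NonDegenerate a)
    (h0 : a ∅ = 0) (hb : StrictMono b) (hc : Monotone c) (hcc : Cancelable c) :
    ExistsEFX a b c := by
  rcases subsingleton_or_nontrivial ι with hs | ⟨x, y, hxy⟩
  · exact existsEFX_of_card_le_one ha.monotone hb.monotone hc (A := univ) (B := ∅) (C := ∅)
      ⟨by simp, by simp, by simp, by simp⟩ (card_le_one_of_subsingleton _) (by simp) (by simp)
  have hp : IsPartition {x} {y} (univ \ {x, y}) :=
    ⟨by simpa using hxy, by simp, by simp, by grind⟩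
  rcases (univ \ {x, y} : Finset ι).eq_empty_or_nonempty with he | hne
  · exact existsEFX_of_card_le_one ha.monotone hb.monotone hc hp (by simp) (by simp) (by simp [he])
  have pos : ∀ S : Finset ι, S.Nonempty → 0 < a S := fun S hS => by
    rw [← h0]; exact ha (empty_ssubset.2 hS)
  obtain ⟨A, B, C, h⟩ := exists_isGood c ha hn h0 hb.monotone le_rfl hp
    (pos _ (singleton_nonempty _)) (pos _ (singleton_nonempty _)) (pos _ hne)
  exact h.existsEFX ha hn h0 hb hc hcc

end ThreeAgents

/-- Every setting with 3 agents whose valuations are nice cancelable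
admits a complete EFX allocation. -/
theorem efx_three_agents_complete
    {ι : Type*} [DecidableEq ι] [Fintype ι]
    (v : Fin 3 → Finset ι → ℝ)
    (hval : ∀ i, IsValuation (v i)) (hnice : ∀ i, NiceCancelable (v i)) :
    ∃ X : Fin 3 → Finset ι, IsPartialAlloc X ∧ IsEFX v X ∧ unalloc X = ∅ := by
  choose w hw hwn hwc hwr using fun i => (hnice i).2
  have hmono i : StrictMono (w i) :=
    strictMono_of_monotone_nonDegenerate (fun _ _ h => (hw i).2.2 h) (hwn i)
  obtain ⟨A, B, C, ⟨d1, d2, d3, d4⟩, hA, hB, hC⟩ := existsEFX_of_cancelable (hmono 0) (hwn 0)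
    (hw 0).1 (hmono 1) (hmono 2).monotone (hwc 2)
  refine ⟨![A, B, C], ?_, ?_, ?_⟩
  · intro i j hij
    fin_cases i <;> fin_cases j <;> first | exact absurd rfl hij | simp [d1, d2, d3, disjoint_comm]
  · have key : ∀ i S T, Feasible (w i) S T → ∀ h ∈ T, ¬ v i S < v i (T.erase h) :=
      fun i S T hf h hh hlt => (hf h hh).not_gt (hwr i _ _ hlt)
    rintro i j hij ⟨h, hh, hlt⟩
    revert hlt
    fin_cases i <;> fin_cases j <;> first
      | exact absurd rfl hij
      | exact key _ _ _ hA.1 h hh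
      | exact key _ _ _ hA.2 h hh
      | exact key _ _ _ hB.1 h hh
      | exact key _ _ _ hB.2 h hh
      | exact key _ _ _ hC.1 h hh
      | exact key _ _ _ hC.2 h hh
  · rw [unalloc, sdiff_eq_empty_iff_subset, ← d4]
    intro x hx
    simp only [mem_biUnion, mem_univ, true_and, Fin.exists_fin_succ]
    simp only [mem_union] at hx
    simp
    tauto

end FairDivision
end

section
/- Fix an arbitrary ordering of 3 agents whose valuations are non-degenerate and cancelable. Let X be a partial EFX allocation with at least one unallocated item. Then there exists a partial EFX allocation Y that dominates X. -/
namespace FairDivision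

open Finset

theorem ParetoDominates.dominates {ι : Type*} {v : Fin 3 → Finset ι → ℝ}
    {X Y : Fin 3 → Finset ι} (h : ParetoDominates v Y X) {a : Fin 3 → Fin 3} (ha : Function.Bijective a) :
    Dominates v a Y X := by
  obtain ⟨hle, i, hi⟩ := h
  obtain ⟨m, rfl⟩ := ha.surjective i
  obtain ⟨k, hk, hmin⟩ := WellFounded.has_min (wellFounded_lt (α := Fin 3))
    {k | v (a k) (X (a k)) < v (a k) (Y (a k))} ⟨m, hi⟩
  exact ⟨k, fun j hj => le_antisymm (not_lt.1 fun h => hmin j h hj) (hle (a j)), hk⟩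

theorem lt_of_ssubset {ι : Type*} {w : Finset ι → ℝ} (hw : IsValuation w) (hn : NonDegenerate w)
    {A B : Finset ι} (hAB : A ⊂ B) : w A < w B :=
  lt_of_le_of_ne (hw.2.2 hAB.1) (hn A B hAB.ne)

section Comparison

variable {ι : Type*} [DecidableEq ι]

/-- An agent with valuation `w` and current value `r` strongly envies `B`. -/
def StrongAt (w : Finset ι → ℝ) (r : ℝ) (B : Finset ι) : Prop :=
  ∃ h ∈ B, r < w (B.erase h)

theorem StrongAt.anti {w : Finset ι → ℝ} {r r' : ℝ} {B : Finset ι}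
    (h : StrongAt w r B) (hr : r' ≤ r) : StrongAt w r' B := by
  obtain ⟨x, hx, hlt⟩ := h
  exact ⟨x, hx, hr.trans_lt hlt⟩

theorem StrongAt.mono {w : Finset ι → ℝ} (hw : IsValuation w) {r : ℝ} {A B : Finset ι}
    (h : StrongAt w r A) (hAB : A ⊆ B) : StrongAt w r B := by
  obtain ⟨x, hx, hlt⟩ := h
  exact ⟨x, hAB hx, hlt.trans_le (hw.2.2 (erase_subset_erase x hAB))⟩

theorem not_strongAt_of_le {w : Finset ι → ℝ} (hw : IsValuation w) {r : ℝ} {B : Finset ι}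
    (h : w B ≤ r) : ¬ StrongAt w r B := by
  rintro ⟨x, -, hlt⟩
  exact absurd (hw.2.2 (erase_subset x B)) (by linarith)

theorem strongAt_of_ssubset {w : Finset ι → ℝ} (hw : IsValuation w) {r : ℝ} {A B : Finset ι}
    (h : r < w A) (hAB : A ⊂ B) : StrongAt w r B := by
  obtain ⟨x, hxB, hxA⟩ := exists_of_ssubset hAB
  exact ⟨x, hxB, h.trans_le (hw.2.2 (subset_erase.2 ⟨hAB.1, hxA⟩))⟩

theorem Cancelable.lt_of_union_lt_s6 {w : Finset ι → ℝ} (hc : Cancelable w) (C : Finset ι)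
    {A B : Finset ι} (hA : Disjoint C A) (hB : Disjoint C B) (h : w (C ∪ A) < w (C ∪ B)) :
    w A < w B := by
  induction C using Finset.induction_on with
  | empty => simpa using h
  | insert x C hx ih =>
    rw [disjoint_insert_left] at hA hB
    refine ih hA.2 hB.2 ?_
    rw [insert_union, insert_union] at h
    refine hc _ _ x ?_ ?_ h
    · simp [hx, hB.1]
    · simp [hx, hA.1]

theorem Cancelable.union_lt_union_iff {w : Finset ι → ℝ} (hc : Cancelable w)
    (hn : NonDegenerate w) {A B C : Finset ι} (hA : Disjoint C A) (hB : Disjoint C B) :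
    w (C ∪ A) < w (C ∪ B) ↔ w A < w B := by
  refine ⟨hc.lt_of_union_lt_s6 C hA hB, fun h => ?_⟩
  rcases lt_trichotomy (w (C ∪ A)) (w (C ∪ B)) with h1 | h1 | h1
  · exact h1
  · exfalso
    have h2 : C ∪ A = C ∪ B := by
      by_contra hne
      exact hn _ _ hne h1
    have h3 : A = B := by
      rw [← union_sdiff_cancel_left hA, h2, union_sdiff_cancel_left hB]
    rw [h3] at h
    exact lt_irrefl _ h
  · exact absurd (hc.lt_of_union_lt_s6 C hB hA h1) (by linarith)

theorem exists_minimal_subset (E : Finset ι → Prop) {S : Finset ι} (hS : E S) :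
    ∃ T ⊆ S, E T ∧ ∀ x ∈ T, ¬ E (T.erase x) := by
  induction S using Finset.strongInduction with
  | H S ih =>
    by_cases h : ∃ x ∈ S, E (S.erase x)
    · obtain ⟨x, hx, hE⟩ := h
      obtain ⟨T, hT, h1, h2⟩ := ih _ (erase_ssubset hx) hE
      exact ⟨T, hT.trans (erase_subset _ _), h1, h2⟩
    · push Not at h
      exact ⟨S, Subset.rfl, hS, h⟩

theorem exists_minimal_envied_pair {u w : Finset ι → ℝ} {r s : ℝ} {S : Finset ι}
    (hS : r < u S ∨ s < w S) :
    ∃ T ⊆ S, (r < u T ∨ s < w T) ∧ ¬ StrongAt u r T ∧ ¬ StrongAt w s T := by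
  obtain ⟨T, hTS, hT, hmin⟩ := exists_minimal_subset (fun T => r < u T ∨ s < w T) hS
  refine ⟨T, hTS, hT, ?_, ?_⟩
  · rintro ⟨x, hx, h⟩
    exact hmin x hx (Or.inl h)
  · rintro ⟨x, hx, h⟩
    exact hmin x hx (Or.inr h)

theorem exists_split {g : ι} {S T : Finset ι} (hT : T ⊆ insert g S) (hgT : g ∈ T)
    (hgS : g ∉ S) :
    ∃ B D : Finset ι, T = B ∪ {g} ∧ S = B ∪ D ∧ Disjoint B D ∧ g ∉ B ∧ g ∉ D := by
  refine ⟨T.erase g, S \ T, ?_, ?_, ?_, ?_, ?_⟩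
  · ext x; grind
  · ext x; grind
  · rw [disjoint_left]; grind
  · grind
  · grind

end Comparison

section ThreeAgents

variable {ι : Type*} [DecidableEq ι]

theorem eq_or_eq_or_eq_of_ne {x y z : Fin 3} (hxy : x ≠ y) (hxz : x ≠ z) (hyz : y ≠ z)
    (l : Fin 3) : l = x ∨ l = y ∨ l = z := by
  omega

/-- `S` is strongly envied by no agent of the allocation `X`. -/
def Unenvied (v : Fin 3 → Finset ι → ℝ) (X : Fin 3 → Finset ι) (S : Finset ι) : Prop :=
  ∀ l, ¬ StrongAt (v l) (v l (X l)) S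

theorem IsEFX.unenvied {v : Fin 3 → Finset ι → ℝ} (hval : ∀ i, IsValuation (v i))
    {X : Fin 3 → Finset ι} (h : IsEFX v X) (j : Fin 3) : Unenvied v X (X j) := by
  intro l
  by_cases hl : l = j
  · subst hl
    exact not_strongAt_of_le (hval l) le_rfl
  · exact h l j hl

theorem exists_unenvied_subset (v : Fin 3 → Finset ι → ℝ) (X : Fin 3 → Finset ι)
    {S : Finset ι} {l : Fin 3} (h : v l (X l) < v l S) :
    ∃ T ⊆ S, Unenvied v X T ∧ ∃ l, v l (X l) < v l T := by
  obtain ⟨T, hTS, hT, hmin⟩ :=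
    exists_minimal_subset (fun T => ∃ l, v l (X l) < v l T) ⟨l, h⟩
  refine ⟨T, hTS, ?_, hT⟩
  rintro l ⟨x, hx, hlt⟩
  exact hmin x hx ⟨l, hlt⟩

/-- The allocation giving `A`, `B`, `C` to the three agents `x`, `y`, `z`. -/
theorem exists_isEFX {v : Fin 3 → Finset ι → ℝ} {x y z : Fin 3}
    (hxy : x ≠ y) (hxz : x ≠ z) (hyz : y ≠ z) {A B C : Finset ι}
    (hAB : Disjoint A B) (hAC : Disjoint A C) (hBC : Disjoint B C)
    (h1 : ¬ StrongAt (v x) (v x A) B) (h2 : ¬ StrongAt (v x) (v x A) C)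
    (h3 : ¬ StrongAt (v y) (v y B) A) (h4 : ¬ StrongAt (v y) (v y B) C)
    (h5 : ¬ StrongAt (v z) (v z C) A) (h6 : ¬ StrongAt (v z) (v z C) B) :
    ∃ Y : Fin 3 → Finset ι, IsPartialAlloc Y ∧ IsEFX v Y ∧ Y x = A ∧ Y y = B ∧ Y z = C := by
  obtain ⟨Y, hx, hy, hz⟩ : ∃ Y : Fin 3 → Finset ι, Y x = A ∧ Y y = B ∧ Y z = C :=
    ⟨fun l => if l = x then A else if l = y then B else C, by simp, by simp [hxy.symm],
      by simp [hxz.symm, hyz.symm]⟩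
  refine ⟨Y, ?_, ?_, hx, hy, hz⟩
  · intro l m hlm
    rcases eq_or_eq_or_eq_of_ne hxy hxz hyz l with rfl | rfl | rfl <;>
    rcases eq_or_eq_or_eq_of_ne hxy hxz hyz m with rfl | rfl | rfl <;>
    first
      | exact absurd rfl hlm
      | (rw [hx, hy]; exact hAB)
      | (rw [hy, hx]; exact hAB.symm)
      | (rw [hx, hz]; exact hAC)
      | (rw [hz, hx]; exact hAC.symm)
      | (rw [hy, hz]; exact hBC)
      | (rw [hz, hy]; exact hBC.symm)
  · intro l m hlm
    change ¬ StrongAt (v l) (v l (Y l)) (Y m)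
    rcases eq_or_eq_or_eq_of_ne hxy hxz hyz l with rfl | rfl | rfl <;>
    rcases eq_or_eq_or_eq_of_ne hxy hxz hyz m with rfl | rfl | rfl <;>
    first
      | exact absurd rfl hlm
      | (rw [hx, hy]; exact h1)
      | (rw [hx, hz]; exact h2)
      | (rw [hy, hx]; exact h3)
      | (rw [hy, hz]; exact h4)
      | (rw [hz, hx]; exact h5)
      | (rw [hz, hy]; exact h6)

/-- Bundles that nobody strongly envies and that are weakly better for their owners
form an EFX allocation. -/
theorem exists_isEFX_of_unenvied {v : Fin 3 → Finset ι → ℝ} {X : Fin 3 → Finset ι}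
    {x y z : Fin 3} (hxy : x ≠ y) (hxz : x ≠ z) (hyz : y ≠ z) {A B C : Finset ι}
    (hAB : Disjoint A B) (hAC : Disjoint A C) (hBC : Disjoint B C)
    (hA : Unenvied v X A) (hB : Unenvied v X B) (hC : Unenvied v X C)
    (hx : v x (X x) ≤ v x A) (hy : v y (X y) ≤ v y B) (hz : v z (X z) ≤ v z C) :
    ∃ Y : Fin 3 → Finset ι, IsPartialAlloc Y ∧ IsEFX v Y ∧ Y x = A ∧ Y y = B ∧ Y z = C :=
  exists_isEFX hxy hxz hyz hAB hAC hBC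
    (fun h => hB x (h.anti hx)) (fun h => hC x (h.anti hx))
    (fun h => hA y (h.anti hy)) (fun h => hC y (h.anti hy))
    (fun h => hA z (h.anti hz)) (fun h => hB z (h.anti hz))

theorem exists_isEFX_of_pieces {v : Fin 3 → Finset ι → ℝ} (hval : ∀ i, IsValuation (v i))
    {x y k : Fin 3} (hxy : x ≠ y) (hxk : x ≠ k) (hyk : y ≠ k) {F G Z : Finset ι}
    (hFG : Disjoint F G) (hFZ : Disjoint F Z) (hGZ : Disjoint G Z)
    (hx1 : ¬ StrongAt (v x) (v x Z) F) (hx2 : ¬ StrongAt (v x) (v x Z) G)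
    (hy : ¬ StrongAt (v y) (max (v y F) (v y G)) Z)
    (hk1 : ¬ StrongAt (v k) (v k G) F) (hk2 : ¬ StrongAt (v k) (v k G) Z)
    (hk3 : ¬ StrongAt (v k) (v k F) G) (hk4 : ¬ StrongAt (v k) (v k F) Z) :
    ∃ Y : Fin 3 → Finset ι, IsPartialAlloc Y ∧ IsEFX v Y ∧
      (Y k = F ∨ Y k = G ∧ ∃ p, p ≠ k ∧ Y p = F) := by
  rcases le_total (v y F) (v y G) with h | h
  · rw [max_eq_right h] at hy
    obtain ⟨Y, h1, h2, -, -, h5⟩ := exists_isEFX hxy hxk hyk hGZ.symm hFZ.symm hFG.symm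
      hx2 hx1 hy (not_strongAt_of_le (hval y) h) hk4 hk3
    exact ⟨Y, h1, h2, Or.inl h5⟩
  · rw [max_eq_left h] at hy
    obtain ⟨Y, h1, h2, -, h4, h5⟩ := exists_isEFX hxy hxk hyk hFZ.symm hGZ.symm hFG
      hx1 hx2 hy (not_strongAt_of_le (hval y) h) hk2 hk1
    exact ⟨Y, h1, h2, Or.inr ⟨h5, y, hyk, h4⟩⟩

/-- Agent `k` can be served `F` or `G` while `i` and `j` share the other one and (a part
of) `R`. -/
theorem exists_isEFX_three_pieces {v : Fin 3 → Finset ι → ℝ}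
    (hval : ∀ i, IsValuation (v i)) {i j k : Fin 3} (hij : i ≠ j) (hik : i ≠ k) (hjk : j ≠ k)
    {F G R : Finset ι} (hFG : Disjoint F G) (hFR : Disjoint F R) (hGR : Disjoint G R)
    (hj1 : ¬ StrongAt (v j) (v j R) F) (hj2 : ¬ StrongAt (v j) (v j R) G)
    (hk1 : ¬ StrongAt (v k) (v k G) F) (hk2 : ¬ StrongAt (v k) (v k G) R)
    (hk3 : ¬ StrongAt (v k) (v k F) G) (hk4 : ¬ StrongAt (v k) (v k F) R) :
    ∃ Y : Fin 3 → Finset ι, IsPartialAlloc Y ∧ IsEFX v Y ∧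
      (Y k = F ∨ Y k = G ∧ ∃ p, p ≠ k ∧ Y p = F) := by
  by_cases h : max (v i F) (v i G) < v i R ∨ max (v j F) (v j G) < v j R
  · obtain ⟨Z, hZR, hZ, hZi, hZj⟩ := exists_minimal_envied_pair h
    have hFZ := disjoint_of_subset_right hZR hFR
    have hGZ := disjoint_of_subset_right hZR hGR
    have hk2' : ¬ StrongAt (v k) (v k G) Z := fun h => hk2 (h.mono (hval k) hZR)
    have hk4' : ¬ StrongAt (v k) (v k F) Z := fun h => hk4 (h.mono (hval k) hZR)
    rcases hZ with hZ | hZ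
    · rw [max_lt_iff] at hZ
      exact exists_isEFX_of_pieces hval hij hik hjk hFG hFZ hGZ
        (not_strongAt_of_le (hval i) hZ.1.le) (not_strongAt_of_le (hval i) hZ.2.le)
        hZj hk1 hk2' hk3 hk4'
    · rw [max_lt_iff] at hZ
      exact exists_isEFX_of_pieces hval hij.symm hjk hik hFG hFZ hGZ
        (not_strongAt_of_le (hval j) hZ.1.le) (not_strongAt_of_le (hval j) hZ.2.le)
        hZi hk1 hk2' hk3 hk4'
  · push Not at h
    exact exists_isEFX_of_pieces hval hij.symm hjk hik hFG hFR hGR hj1 hj2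
      (not_strongAt_of_le (hval i) h.1) hk1 hk2 hk3 hk4

theorem exists_splits {g : ι} {S S' T T' : Finset ι} (hT : T ⊆ insert g S) (hgT : g ∈ T)
    (hgS : g ∉ S) (hT' : T' ⊆ insert g S') (hgT' : g ∈ T') (hgS' : g ∉ S')
    (hd : Disjoint S S') :
    ∃ B D B' D' : Finset ι, T = B ∪ {g} ∧ S = B ∪ D ∧ T' = B' ∪ {g} ∧ S' = B' ∪ D' ∧
      Disjoint B D ∧ Disjoint B' D' ∧ Disjoint B B' ∧ Disjoint B D' ∧ Disjoint D B' ∧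
      Disjoint D D' ∧ g ∉ B ∧ g ∉ D ∧ g ∉ B' ∧ g ∉ D' := by
  obtain ⟨B, D, h1, h2, h3, h4, h5⟩ := exists_split hT hgT hgS
  obtain ⟨B', D', h1', h2', h3', h4', h5'⟩ := exists_split hT' hgT' hgS'
  rw [h2, h2', disjoint_union_left, disjoint_union_right, disjoint_union_right] at hd
  exact ⟨B, D, B', D', h1, h2, h1', h2', h3, h3', hd.1.1, hd.1.2, hd.2.1, hd.2.2,
    h4, h5, h4', h5'⟩

theorem exists_champion {v : Fin 3 → Finset ι → ℝ} (hval : ∀ i, IsValuation (v i))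
    (hnd : ∀ i, NonDegenerate (v i)) (X : Fin 3 → Finset ι) {g : ι} {s : Fin 3}
    (hg : g ∉ X s) :
    ∃ T ⊆ insert g (X s), Unenvied v X T ∧ ∃ l, v l (X l) < v l T :=
  exists_unenvied_subset v X (l := s) (lt_of_ssubset (hval s) (hnd s) (ssubset_insert hg))

/-- If `i` envies `p` and some item `g` is unallocated, then either `i` can be improved, or
there is a Pareto improvement keeping the bundle of `i` and the one that `i` envies. -/
theorem exists_improvement_of_envy {v : Fin 3 → Finset ι → ℝ}
    (hval : ∀ i, IsValuation (v i)) (hnd : ∀ i, NonDegenerate (v i))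
    (hc : ∀ i, Cancelable (v i)) {i p k : Fin 3} (hip : i ≠ p) (hik : i ≠ k) (hpk : p ≠ k)
    {X : Fin 3 → Finset ι} (hX : IsPartialAlloc X) (hEFX : IsEFX v X)
    (henvy : v i (X i) < v i (X p)) {g : ι} (hg : ∀ l, g ∉ X l) :
    (∃ Y : Fin 3 → Finset ι, IsPartialAlloc Y ∧ IsEFX v Y ∧ v i (X i) < v i (Y i)) ∨
    (∃ Y : Fin 3 → Finset ι, IsPartialAlloc Y ∧ IsEFX v Y ∧ Y i = X i ∧
      (∃ q, q ≠ i ∧ Y q = X p) ∧ ParetoDominates v Y X) := by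
  by_contra hno
  push Not at hno
  obtain ⟨hno1, hno2⟩ := hno
  have hgi := hg i
  have hgp := hg p
  have hgk := hg k
  have Ui := hEFX.unenvied hval i
  have Up := hEFX.unenvied hval p
  have Uk := hEFX.unenvied hval k
  obtain ⟨Ti, hTi, UTi, l, hl⟩ := exists_champion hval hnd X hgi
  obtain ⟨Tk, hTk, UTk, l', hl'⟩ := exists_champion hval hnd X hgk
  have dTi_p : Disjoint Ti (X p) :=
    (disjoint_insert_left.2 ⟨hgp, hX i p hip⟩).mono_left hTi
  have dTi_k : Disjoint Ti (X k) :=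
    (disjoint_insert_left.2 ⟨hgk, hX i k hik⟩).mono_left hTi
  have dTk_p : Disjoint Tk (X p) :=
    (disjoint_insert_left.2 ⟨hgp, hX k p hpk.symm⟩).mono_left hTk
  have dTk_i : Disjoint Tk (X i) :=
    (disjoint_insert_left.2 ⟨hgi, hX k i hik.symm⟩).mono_left hTk
  have improve : ∀ A B C : Finset ι, Unenvied v X A → Unenvied v X B → Unenvied v X C →
      v i (X i) < v i A → v p (X p) ≤ v p B → v k (X k) ≤ v k C →
      Disjoint A B → Disjoint A C → Disjoint B C → False := by
    intro A B C hA hB hC h1 h2 h3 hAB hAC hBC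
    obtain ⟨Y, hY, hY', rfl, -, -⟩ :=
      exists_isEFX_of_unenvied hip hik hpk hAB hAC hBC hA hB hC h1.le h2 h3
    exact absurd h1 (not_lt.2 (hno1 Y hY hY'))
  have keep : ∀ B C : Finset ι, Unenvied v X B → Unenvied v X C →
      v p (X p) ≤ v p B → v k (X k) ≤ v k C → (B = X p ∨ C = X p) →
      (v p (X p) < v p B ∨ v k (X k) < v k C) →
      Disjoint (X i) B → Disjoint (X i) C → Disjoint B C → False := by
    intro B C hB hC h2 h3 hBC' hlt hAB hAC hBC
    obtain ⟨Y, hY, hY', h4, rfl, rfl⟩ :=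
      exists_isEFX_of_unenvied hip hik hpk hAB hAC hBC Ui hB hC le_rfl h2 h3
    refine hno2 Y hY hY' h4 ?_ ⟨?_, ?_⟩
    · rcases hBC' with h | h
      · exact ⟨p, hip.symm, h⟩
      · exact ⟨k, hik.symm, h⟩
    · intro l
      rcases eq_or_eq_or_eq_of_ne hip hik hpk l with rfl | rfl | rfl
      · rw [h4]
      · exact h2
      · exact h3
    · rcases hlt with h | h
      · exact ⟨p, h⟩
      · exact ⟨k, h⟩
  have Ti_i : v i Ti ≤ v i (X i) := by
    by_contra! h
    exact improve Ti (X p) (X k) UTi Up Uk h le_rfl le_rfl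
      dTi_p dTi_k (hX p k hpk)
  have Ti_p : v p Ti ≤ v p (X p) := by
    by_contra! h
    exact improve (X p) Ti (X k) Up UTi Uk henvy h.le le_rfl
      dTi_p.symm (hX p k hpk) dTi_k
  have Ti_k : v k (X k) < v k Ti := by
    rcases eq_or_eq_or_eq_of_ne hip hik hpk l with rfl | rfl | rfl
    · exact absurd hl (not_lt.2 Ti_i)
    · exact absurd hl (not_lt.2 Ti_p)
    · exact hl
  have Xi_p : v p (X i) ≤ v p (X p) := by
    by_contra! h
    exact improve (X p) (X i) (X k) Up Ui Uk henvy h.le le_rfl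
      (hX p i hip.symm) (hX p k hpk) (hX i k hik)
  have Xk_i : v i (X k) ≤ v i (X i) := by
    by_contra! h
    exact improve (X k) (X p) Ti Uk Up UTi h le_rfl Ti_k.le
      (hX k p hpk.symm) dTi_k.symm dTi_p.symm
  have Xk_p : v p (X k) ≤ v p (X p) := by
    by_contra! h
    exact improve (X p) (X k) Ti Up Uk UTi henvy h.le Ti_k.le
      (hX p k hpk) dTi_p.symm dTi_k.symm
  have Tk_k : v k Tk ≤ v k (X k) := by
    by_contra! h
    exact keep (X p) Tk Up UTk le_rfl h.le (Or.inl rfl) (Or.inr h)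
      (hX i p hip) dTk_i.symm dTk_p.symm
  have Xi_k : v k (X i) ≤ v k (X k) := by
    by_contra! h
    rcases eq_or_eq_or_eq_of_ne hip hik hpk l' with rfl | rfl | rfl
    · exact improve Tk (X p) (X l') UTk Up Ui hl' le_rfl h.le
        dTk_p dTk_i (hX p l' hip.symm)
    · exact improve (X l') Tk (X i) Up UTk Ui henvy hl'.le h.le
        dTk_p.symm (hX l' i hip.symm) dTk_i
    · exact absurd hl' (not_lt.2 Tk_k)
  have hgTi : g ∈ Ti := by
    by_contra h
    have : Ti ⊆ X i := (subset_insert_iff_of_notMem h).1 hTi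
    exact absurd ((hval k).2.2 this) (by linarith)
  have hgTk : g ∈ Tk := by
    by_contra h
    have hs : Tk ⊆ X k := (subset_insert_iff_of_notMem h).1 hTk
    have h1 := (hval i).2.2 hs
    have h2 := (hval p).2.2 hs
    have h3 := (hval k).2.2 hs
    rcases eq_or_eq_or_eq_of_ne hip hik hpk l' with rfl | rfl | rfl <;> linarith
  obtain ⟨B, D, B', D', eTi, eXi, eTk, eXk, dBD, dBD', dBB', dB_D', dDB', dDD', gB, gD, gB', gD'⟩ :=
    exists_splits hTi hgTi hgi hTk hgTk hgk (hX i k hik)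
  have gBs : Disjoint B {g} := by simpa using gB
  have gBs' : Disjoint B' {g} := by simpa using gB'
  have dB'p : Disjoint B' (X p) := (hX k p hpk.symm).mono_left (eXk ▸ subset_union_left)
  have dDp : Disjoint D (X p) := (hX i p hip).mono_left (eXi ▸ subset_union_right)
  have hDk : v k D < v k {g} := by
    rw [← (hc k).union_lt_union_iff (hnd k) dBD gBs, ← eTi, ← eXi]
    linarith
  have hne : ∀ l, v l (X k) ≠ v l Tk := fun l => hnd l _ _ fun h => hgk (h ▸ hgTk)
  by_cases hTk_i : v i (X i) < v i Tk
  · have hW : v i (X i) < v i (B' ∪ D) := by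
      refine hTk_i.trans ?_
      rw [eTk, (hc i).union_lt_union_iff (hnd i) gBs' dDB'.symm,
        ← (hc i).union_lt_union_iff (hnd i) gBs dBD, ← eTi, ← eXi]
      exact lt_of_le_of_ne Ti_i (hnd i _ _ fun h => hgi (h ▸ hgTi))
    obtain ⟨W, hWs, UW, m, hm⟩ := exists_unenvied_subset v X hW
    have dWp : Disjoint W (X p) := (disjoint_union_left.2 ⟨dB'p, dDp⟩).mono_left hWs
    have dWTi : Disjoint W Ti := by
      refine disjoint_of_subset_left hWs ?_
      rw [eTi]
      simp [dBB'.symm, dBD.symm, gB', gD]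
    rcases eq_or_eq_or_eq_of_ne hip hik hpk m with rfl | rfl | rfl
    · exact improve W (X p) Ti UW Up UTi hm le_rfl Ti_k.le
        dWp dWTi
        dTi_p.symm
    · exact improve (X m) W Ti Up UW UTi henvy hm.le Ti_k.le
        dWp.symm dTi_p.symm
        dWTi
    · have h1 := (hval m).2.2 hWs
      have h2 : v m (B' ∪ D) < v m Tk := by
        rwa [eTk, (hc m).union_lt_union_iff (hnd m) dDB'.symm gBs']
      linarith
  · push Not at hTk_i
    have hTk_p : v p (X p) < v p Tk := by
      rcases eq_or_eq_or_eq_of_ne hip hik hpk l' with rfl | rfl | rfl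
      · exact absurd hl' (not_lt.2 hTk_i)
      · exact hl'
      · exact absurd hl' (not_lt.2 Tk_k)
    have Xp_k : v k (X p) ≤ v k (X k) := by
      by_contra! h
      exact keep Tk (X p) UTk Up hTk_p.le h.le (Or.inr rfl) (Or.inl hTk_p)
        dTk_i.symm (hX i p hip) dTk_p
    have hP_p : v p (B ∪ D') < v p Ti := by
      rw [eTi, (hc p).union_lt_union_iff (hnd p) dB_D' gBs,
        ← (hc p).union_lt_union_iff (hnd p) dBD' gBs', ← eTk, ← eXk]
      exact Xk_p.trans_lt hTk_p
    have hP_k : v k Ti < v k (B ∪ D') := by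
      rw [eTi, (hc k).union_lt_union_iff (hnd k) gBs dB_D',
        ← (hc k).union_lt_union_iff (hnd k) gBs' dBD', ← eTk, ← eXk]
      exact lt_of_le_of_ne Tk_k (hne k).symm
    have hmax : max (v k (X p)) (v k Tk) < v k (B ∪ D') :=
      (max_le Xp_k Tk_k).trans_lt (Ti_k.trans hP_k)
    obtain ⟨S, hS, hSenvy, hSi, hSk⟩ :=
      exists_minimal_envied_pair (u := v i) (r := v i (X p)) (Or.inr hmax)
    have hSp : v p S < v p (X p) := (((hval p).2.2 hS).trans_lt hP_p).trans_le Ti_p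
    have dBp : Disjoint B (X p) := (hX i p hip).mono_left (eXi ▸ subset_union_left)
    have dD'p : Disjoint D' (X p) := (hX k p hpk.symm).mono_left (eXk ▸ subset_union_right)
    have dSp : Disjoint S (X p) := (disjoint_union_left.2 ⟨dBp, dD'p⟩).mono_left hS
    have dSTk : Disjoint S Tk := by
      refine disjoint_of_subset_left hS ?_
      rw [eTk]
      simp [dBB', dBD'.symm, gB, gD']
    rcases hSenvy with h | h
    · rcases le_total (v k Tk) (v k (X p)) with hle | hle
      · rw [max_eq_left hle] at hSk
        obtain ⟨Y, hY, hY', rfl, -, -⟩ := exists_isEFX hip hik hpk dSTk dSp dTk_p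
          (not_strongAt_of_le (hval i) (by linarith)) (not_strongAt_of_le (hval i) h.le)
          (not_strongAt_of_le (hval p) (by linarith)) (not_strongAt_of_le (hval p) hTk_p.le)
          hSk (not_strongAt_of_le (hval k) hle)
        exact absurd (hno1 Y hY hY') (by linarith)
      · rw [max_eq_right hle] at hSk
        obtain ⟨Y, hY, hY', rfl, -, -⟩ := exists_isEFX hip hik hpk dSp dSTk dTk_p.symm
          (not_strongAt_of_le (hval i) h.le) (not_strongAt_of_le (hval i) (by linarith))
          (not_strongAt_of_le (hval p) hSp.le) (UTk p)
          hSk (not_strongAt_of_le (hval k) hle)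
        exact absurd (hno1 Y hY hY') (by linarith)
    · rw [max_lt_iff] at h
      obtain ⟨Y, hY, hY', h1, -, -⟩ := exists_isEFX hip hik hpk dTk_p.symm dSp.symm dSTk.symm
        (not_strongAt_of_le (hval i) (by linarith)) hSi
        (not_strongAt_of_le (hval p) hTk_p.le) (not_strongAt_of_le (hval p) (by linarith))
        (not_strongAt_of_le (hval k) h.1.le) (not_strongAt_of_le (hval k) h.2.le)
      have h2 := hno1 Y hY hY'
      rw [h1] at h2
      exact absurd h2 (by linarith)

theorem exists_third (i p : Fin 3) : ∃ k : Fin 3, i ≠ k ∧ p ≠ k := by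
  decide +revert

theorem mem_unalloc_iff [Fintype ι] {X : Fin 3 → Finset ι} {g : ι} :
    g ∈ unalloc X ↔ ∀ l, g ∉ X l := by
  simp [unalloc]

/-- If `i` envies `p`, then either `i` can be improved, or there is a complete EFX allocation
that keeps the bundle of `i` and the one that `i` envies. -/
theorem exists_improvement_or_complete_of_envy [Fintype ι] {v : Fin 3 → Finset ι → ℝ}
    (hval : ∀ i, IsValuation (v i)) (hnd : ∀ i, NonDegenerate (v i))
    (hc : ∀ i, Cancelable (v i)) {i p : Fin 3} (hip : i ≠ p)
    {X : Fin 3 → Finset ι} (hX : IsPartialAlloc X) (hEFX : IsEFX v X)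
    (henvy : v i (X i) < v i (X p)) :
    (∃ Y : Fin 3 → Finset ι, IsPartialAlloc Y ∧ IsEFX v Y ∧ v i (X i) < v i (Y i)) ∨
    (∃ Y : Fin 3 → Finset ι, IsPartialAlloc Y ∧ IsEFX v Y ∧ unalloc Y = ∅ ∧ Y i = X i ∧
      (∃ q, q ≠ i ∧ Y q = X p) ∧ ∀ l, v l (X l) ≤ v l (Y l)) := by
  obtain ⟨Y, ⟨hY, hY', h1, ⟨q, hqi, hq⟩, h3⟩, hmax⟩ := Set.exists_max_image
    {Y : Fin 3 → Finset ι | IsPartialAlloc Y ∧ IsEFX v Y ∧ Y i = X i ∧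
      (∃ q, q ≠ i ∧ Y q = X p) ∧ ∀ l, v l (X l) ≤ v l (Y l)}
    (fun Y => ∑ l, v l (Y l)) (Set.toFinite _)
    ⟨X, hX, hEFX, rfl, ⟨p, hip.symm, rfl⟩, fun _ => le_rfl⟩
  rcases (unalloc Y).eq_empty_or_nonempty with h | ⟨g, hg⟩
  · exact Or.inr ⟨Y, hY, hY', h, h1, ⟨q, hqi, hq⟩, h3⟩
  obtain ⟨k, hik, hqk⟩ := exists_third i q
  rcases exists_improvement_of_envy hval hnd hc hqi.symm hik hqk hY hY'
    (by rwa [h1, hq]) (mem_unalloc_iff.1 hg) with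
    ⟨Z, hZ, hZ', hlt⟩ | ⟨Z, hZ, hZ', h4, ⟨r, hri, hr⟩, h5, l, hl⟩
  · exact Or.inl ⟨Z, hZ, hZ', by rwa [h1] at hlt⟩
  · have h6 := hmax Z ⟨hZ, hZ', h4.trans h1, ⟨r, hri, hr.trans hq⟩, fun l => (h3 l).trans (h5 l)⟩
    exact absurd h6 (not_le.2 (sum_lt_sum (fun l _ => h5 l) ⟨l, mem_univ l, hl⟩))

/-- If `i` prefers `F` to its bundle, then, provided that `F` can be shared with a third
bundle `R`, either `i` can be improved or its bundle and `F` belong to a complete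
EFX allocation. -/
theorem exists_improvement_or_complete [Fintype ι] {v : Fin 3 → Finset ι → ℝ}
    (hval : ∀ i, IsValuation (v i)) (hnd : ∀ i, NonDegenerate (v i))
    (hc : ∀ i, Cancelable (v i)) {i x y : Fin 3} (hix : i ≠ x) (hiy : i ≠ y) (hxy : x ≠ y)
    {F E R : Finset ι} (hFE : Disjoint F E) (hFR : Disjoint F R) (hER : Disjoint E R)
    (hlt : v i E < v i F) (hF : ¬ StrongAt (v i) (v i E) F) (hR : ¬ StrongAt (v i) (v i E) R)
    (hxF : ¬ StrongAt (v x) (v x R) F) (hxE : ¬ StrongAt (v x) (v x R) E) :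
    (∃ Y : Fin 3 → Finset ι, IsPartialAlloc Y ∧ IsEFX v Y ∧ v i E < v i (Y i)) ∨
    (∃ Y : Fin 3 → Finset ι, IsPartialAlloc Y ∧ IsEFX v Y ∧ unalloc Y = ∅ ∧ Y i = E ∧
      ∃ q, q ≠ i ∧ Y q = F) := by
  obtain ⟨Y, hY, hY', rfl | ⟨rfl, p, hp, rfl⟩⟩ := exists_isEFX_three_pieces hval hxy.symm hiy.symm
    hix.symm hFE hFR hER hxF hxE hF hR (not_strongAt_of_le (hval i) hlt.le)
    (fun h => hR (h.anti hlt.le))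
  · exact Or.inl ⟨Y, hY, hY', hlt⟩
  · rcases exists_improvement_or_complete_of_envy hval hnd hc hp.symm hY hY' hlt with
      h | ⟨Z, hZ, hZ', h1, h2, h3, -⟩
    · exact Or.inl h
    · exact Or.inr ⟨Z, hZ, hZ', h1, h2, h3⟩

theorem subset_of_unalloc_eq_empty [Fintype ι] {X : Fin 3 → Finset ι} (hX : unalloc X = ∅)
    {x y z : Fin 3} (hxy : x ≠ y) (hxz : x ≠ z) (hyz : y ≠ z) {S : Finset ι}
    (hx : Disjoint S (X x)) (hy : Disjoint S (X y)) : S ⊆ X z := by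
  intro g hg
  by_contra hz
  have : g ∈ unalloc X := by
    rw [mem_unalloc_iff]
    intro l
    rcases eq_or_eq_or_eq_of_ne hxy hxz hyz l with rfl | rfl | rfl
    · exact disjoint_left.1 hx hg
    · exact disjoint_left.1 hy hg
    · exact hz
  simp [hX] at this

theorem false_of_pareto_improvement {v : Fin 3 → Finset ι → ℝ} {X : Fin 3 → Finset ι}
    (hno : ∀ Y : Fin 3 → Finset ι, IsPartialAlloc Y → IsEFX v Y → ¬ ParetoDominates v Y X)
    {x y z : Fin 3} (hxy : x ≠ y) (hxz : x ≠ z) (hyz : y ≠ z) {A B C : Finset ι}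
    (hAB : Disjoint A B) (hAC : Disjoint A C) (hBC : Disjoint B C)
    (hA : Unenvied v X A) (hB : Unenvied v X B) (hC : Unenvied v X C)
    (hx : v x (X x) < v x A) (hy : v y (X y) ≤ v y B) (hz : v z (X z) ≤ v z C) : False := by
  obtain ⟨Y, hY, hY', rfl, rfl, rfl⟩ :=
    exists_isEFX_of_unenvied hxy hxz hyz hAB hAC hBC hA hB hC hx.le hy hz
  refine hno Y hY hY' ⟨fun l => ?_, x, hx⟩
  rcases eq_or_eq_or_eq_of_ne hxy hxz hyz l with rfl | rfl | rfl
  exacts [hx.le, hy, hz]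

theorem not_self_champion {v : Fin 3 → Finset ι → ℝ} (hval : ∀ i, IsValuation (v i))
    {X : Fin 3 → Finset ι} (hX : IsPartialAlloc X) (hEFX : IsEFX v X)
    (hno : ∀ Y : Fin 3 → Finset ι, IsPartialAlloc Y → IsEFX v Y → ¬ ParetoDominates v Y X)
    {g : ι} (hg : ∀ l, g ∉ X l) {s y z : Fin 3} (hsy : s ≠ y) (hsz : s ≠ z) (hyz : y ≠ z)
    {T : Finset ι} (hT : T ⊆ insert g (X s)) (hT' : Unenvied v X T) :
    v s T ≤ v s (X s) := by
  by_contra! h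
  exact false_of_pareto_improvement hno hsy hsz hyz
    ((disjoint_insert_left.2 ⟨hg y, hX s y hsy⟩).mono_left hT)
    ((disjoint_insert_left.2 ⟨hg z, hX s z hsz⟩).mono_left hT) (hX y z hyz)
    hT' (hEFX.unenvied hval y) (hEFX.unenvied hval z) h le_rfl le_rfl

/-- If no improvement for `a` and no Pareto improvement exists, then `a` cannot champion an
agent `j` that champions the third agent `i`. -/
theorem false_of_champion_chain [Fintype ι] {v : Fin 3 → Finset ι → ℝ}
    (hval : ∀ i, IsValuation (v i)) (hnd : ∀ i, NonDegenerate (v i))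
    (hc : ∀ i, Cancelable (v i)) {a j i : Fin 3} (haj : a ≠ j) (hai : a ≠ i) (hji : j ≠ i)
    {X : Fin 3 → Finset ι} (hX : IsPartialAlloc X) (hEFX : IsEFX v X)
    (hno1 : ∀ Y : Fin 3 → Finset ι, IsPartialAlloc Y → IsEFX v Y → v a (Y a) ≤ v a (X a))
    (hno2 : ∀ Y : Fin 3 → Finset ι, IsPartialAlloc Y → IsEFX v Y → ¬ ParetoDominates v Y X)
    {g : ι} (hg : ∀ l, g ∉ X l) (hXj : v a (X j) ≤ v a (X a)) {Tj Ti : Finset ι}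
    (hTj : Tj ⊆ insert g (X j)) (UTj : Unenvied v X Tj)
    (hTi : Ti ⊆ insert g (X i)) (UTi : Unenvied v X Ti)
    (hcaj : v a (X a) < v a Tj) (hcji : v j (X j) < v j Ti) : False := by
  have Tj_j := not_self_champion hval hX hEFX hno2 hg haj.symm hji hai hTj UTj
  have Ti_i := not_self_champion hval hX hEFX hno2 hg hai.symm hji.symm haj hTi UTi
  have hgTj : g ∈ Tj := by
    by_contra h
    have := (hval a).2.2 ((subset_insert_iff_of_notMem h).1 hTj)
    linarith
  obtain ⟨B, D, eTj, eXj, dBD, gB, gD⟩ := exists_split hTj hgTj (hg j)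
  have gBs : Disjoint B {g} := by simpa using gB
  have hD : v j {g} < v j D := by
    rw [← (hc j).union_lt_union_iff (hnd j) gBs dBD, ← eTj, ← eXj]
    exact lt_of_le_of_ne Tj_j (hnd j _ _ fun h => hg j (h ▸ hgTj))
  have dDi : Disjoint D (X i) := (hX j i hji).mono_left (eXj ▸ subset_union_right)
  have dDa : Disjoint D (X a) := (hX j a haj.symm).mono_left (eXj ▸ subset_union_right)
  have hDne : D.Nonempty := by
    rw [nonempty_iff_ne_empty]
    rintro rfl
    exact absurd ((hval j).2.2 (empty_subset {g})) (not_le.2 hD)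
  obtain ⟨V, hV, hVj⟩ : ∃ V ⊂ X i ∪ D, v j (X j) < v j V := by
    by_cases hgTi : g ∈ Ti
    · obtain ⟨B', D', eTi, eXi, dBD', gB', gD'⟩ := exists_split hTi hgTi (hg i)
      have gBs' : Disjoint B' {g} := by simpa using gB'
      rw [eXi, disjoint_union_right] at dDi
      refine ⟨B' ∪ D, ?_, hcji.trans ?_⟩
      · refine ⟨?_, fun h => ?_⟩
        · rw [eXi]
          exact union_subset_union_left subset_union_left
        · have hD' : D' = ∅ := by
            rw [← disjoint_self_iff_empty]
            refine Disjoint.mono_right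
              ((eXi ▸ subset_union_right : D' ⊆ X i).trans (subset_union_left.trans h)) ?_
            exact disjoint_union_right.2 ⟨dBD'.symm, dDi.2.symm⟩
          have hXT : X i ⊆ Ti := by
            rw [eXi, hD', union_empty, eTi]
            exact subset_union_left
          exact hnd i (X i) Ti (fun h => hg i (h ▸ hgTi)) (le_antisymm ((hval i).2.2 hXT) Ti_i)
      · rw [eTi]
        exact ((hc j).union_lt_union_iff (hnd j) gBs' dDi.1.symm).2 hD
    · refine ⟨X i, ⟨subset_union_left, fun h => ?_⟩,
        hcji.trans_le ((hval j).2.2 ((subset_insert_iff_of_notMem hgTi).1 hTi))⟩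
      obtain ⟨x, hx⟩ := hDne
      exact disjoint_left.1 dDi hx (h (mem_union_right _ hx))
  have hVi : X i ⊂ X i ∪ D := by
    refine ⟨subset_union_left, fun h => ?_⟩
    obtain ⟨x, hx⟩ := hDne
    exact disjoint_left.1 dDi hx (h (mem_union_right _ hx))
  have dTj_a : Disjoint Tj (X a) :=
    (disjoint_insert_left.2 ⟨hg a, hX j a haj.symm⟩).mono_left hTj
  have dTj_i : Disjoint Tj (X i) :=
    (disjoint_insert_left.2 ⟨hg i, hX j i hji⟩).mono_left hTj
  have dDTj : Disjoint D Tj := by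
    rw [eTj]
    simp [dBD.symm, gD]
  rcases exists_improvement_or_complete hval hnd hc hai haj hji.symm dTj_a dTj_i (hX a i hai)
    hcaj (UTj a) (hEFX a i hai) (UTj i) (hEFX i a hai.symm) with
    ⟨Y, hY, hY', hlt⟩ | ⟨Y, hY, hY', hU, hYa, q, hq, hYq⟩
  · exact absurd hlt (not_lt.2 (hno1 Y hY hY'))
  have hrest : ∀ r, a ≠ r → q ≠ r → X i ∪ D ⊆ Y r := by
    intro r har hqr
    refine subset_of_unalloc_eq_empty hU hq.symm har hqr ?_ ?_
    · rw [hYa]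
      exact disjoint_union_left.2 ⟨hX i a hai.symm, dDa⟩
    · rw [hYq]
      exact disjoint_union_left.2 ⟨dTj_i.symm, dDTj⟩
  rcases eq_or_eq_or_eq_of_ne haj hai hji q with rfl | rfl | rfl
  · exact hq rfl
  · refine hY' q i hji (strongAt_of_ssubset (hval q) ?_ (hV.trans_subset (hrest i hai hji)))
    rw [hYq]
    exact Tj_j.trans_lt hVj
  · have hsub := hrest j haj hji.symm
    refine hno2 Y hY hY' ⟨fun l => ?_, j, hVj.trans_le ((hval j).2.2 (hV.1.trans hsub))⟩
    rcases eq_or_eq_or_eq_of_ne haj hai hji l with rfl | rfl | rfl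
    · rw [hYa]
    · exact (hVj.trans_le ((hval l).2.2 (hV.1.trans hsub))).le
    · by_contra! h
      exact hY' l j hji.symm (strongAt_of_ssubset (hval l) h (hVi.trans_subset hsub))

/-- If `a` champions both `i` and `j` while `j` champions `a`, then `a` can be improved. -/
theorem exists_improvement_of_champion_cycle {v : Fin 3 → Finset ι → ℝ}
    (hval : ∀ i, IsValuation (v i)) (hnd : ∀ i, NonDegenerate (v i))
    (hc : ∀ i, Cancelable (v i)) {a j i : Fin 3} (haj : a ≠ j) (hai : a ≠ i) (hji : j ≠ i)
    {X : Fin 3 → Finset ι} (hX : IsPartialAlloc X) (hEFX : IsEFX v X)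
    (hno2 : ∀ Y : Fin 3 → Finset ι, IsPartialAlloc Y → IsEFX v Y → ¬ ParetoDominates v Y X)
    {g : ι} (hg : ∀ l, g ∉ X l) (hXj : v a (X j) ≤ v a (X a)) {Ta Tj Ti : Finset ι}
    (hTa : Ta ⊆ insert g (X a)) (UTa : Unenvied v X Ta)
    (hTj : Tj ⊆ insert g (X j)) (UTj : Unenvied v X Tj)
    (hTi : Ti ⊆ insert g (X i)) (UTi : Unenvied v X Ti)
    (hcai : v a (X a) < v a Ti) (hcaj : v a (X a) < v a Tj) (hcja : v j (X j) < v j Ta) :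
    ∃ Y : Fin 3 → Finset ι, IsPartialAlloc Y ∧ IsEFX v Y ∧ v a (X a) < v a (Y a) := by
  have Ta_a := not_self_champion hval hX hEFX hno2 hg haj hai hji hTa UTa
  have Tj_j := not_self_champion hval hX hEFX hno2 hg haj.symm hji hai hTj UTj
  have Xa_j : v j (X a) ≤ v j (X j) := by
    by_contra! h
    exact false_of_pareto_improvement hno2 haj hai hji
      ((disjoint_insert_left.2 ⟨hg a, hX j a haj.symm⟩).mono_left hTj)
      ((disjoint_insert_left.2 ⟨hg i, hX j i hji⟩).mono_left hTj) (hX a i hai)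
      UTj (hEFX.unenvied hval a) (hEFX.unenvied hval i) hcaj h.le le_rfl
  have hgTa : g ∈ Ta := by
    by_contra h
    have := (hval j).2.2 ((subset_insert_iff_of_notMem h).1 hTa)
    linarith
  have hgTj : g ∈ Tj := by
    by_contra h
    have := (hval a).2.2 ((subset_insert_iff_of_notMem h).1 hTj)
    linarith
  obtain ⟨B, D, B', D', eTa, eXa, eTj, eXj, dBD, dBD', dBB', dB_D', dDB', dDD', gB, gD, gB', gD'⟩ :=
    exists_splits hTa hgTa (hg a) hTj hgTj (hg j) (hX a j haj)
  have gBs : Disjoint B {g} := by simpa using gB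
  have gBs' : Disjoint B' {g} := by simpa using gB'
  have hD_a : v a {g} < v a D := by
    rw [← (hc a).union_lt_union_iff (hnd a) gBs dBD, ← eTa, ← eXa]
    exact lt_of_le_of_ne Ta_a (hnd a _ _ fun h => hg a (h ▸ hgTa))
  have hD'_a : v a D' < v a {g} := by
    rw [← (hc a).union_lt_union_iff (hnd a) dBD' gBs', ← eTj, ← eXj]
    exact hXj.trans_lt hcaj
  have hD'_j : v j {g} < v j D' := by
    rw [← (hc j).union_lt_union_iff (hnd j) gBs' dBD', ← eTj, ← eXj]
    exact lt_of_le_of_ne Tj_j (hnd j _ _ fun h => hg j (h ▸ hgTj))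
  have hD_j : v j D < v j {g} := by
    rw [← (hc j).union_lt_union_iff (hnd j) dBD gBs, ← eTa, ← eXa]
    exact Xa_j.trans_lt hcja
  have hP_a : v a (B ∪ D') < v a (X a) := by
    rw [eXa, (hc a).union_lt_union_iff (hnd a) dB_D' dBD]
    exact hD'_a.trans hD_a
  have hP_j : v j (X j) < v j (B ∪ D') := by
    refine hcja.trans ?_
    rwa [eTa, (hc j).union_lt_union_iff (hnd j) gBs dB_D']
  have hQ_a : v a (X a) < v a (B' ∪ D) := by
    refine hcaj.trans ?_
    rwa [eTj, (hc a).union_lt_union_iff (hnd a) gBs' dDB'.symm]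
  have hQ_j : v j (B' ∪ D) < v j (X j) := by
    rw [eXj, (hc j).union_lt_union_iff (hnd j) dDB'.symm dBD']
    exact hD_j.trans hD'_j
  obtain ⟨A, hA, hAa, hAmin⟩ := exists_minimal_subset (fun T => v a (X a) < v a T) hQ_a
  have hAs : ¬ StrongAt (v a) (v a (X a)) A := fun ⟨x, hx, h⟩ => hAmin x hx h
  have dTi_a : Disjoint Ti (X a) :=
    (disjoint_insert_left.2 ⟨hg a, hX i a hai.symm⟩).mono_left hTi
  have dTi_j : Disjoint Ti (X j) :=
    (disjoint_insert_left.2 ⟨hg j, hX i j hji.symm⟩).mono_left hTi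
  rw [eXa, disjoint_union_right] at dTi_a
  rw [eXj, disjoint_union_right] at dTi_j
  have dAP : Disjoint A (B ∪ D') := by
    refine disjoint_of_subset_left hA ?_
    simp only [disjoint_union_left, disjoint_union_right]
    exact ⟨⟨dBB'.symm, dBD.symm⟩, dBD', dDD'⟩
  obtain ⟨Y, hY, hY', h⟩ := exists_isEFX_three_pieces hval hji.symm hai.symm haj.symm
    ((disjoint_union_right.2 ⟨dTi_j.1, dTi_a.2⟩).mono_right hA)
    (disjoint_union_right.2 ⟨dTi_a.1, dTi_j.2⟩) dAP
    (fun h => UTi j (h.anti hP_j.le))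
    (not_strongAt_of_le (hval j) (((hval j).2.2 hA).trans (hQ_j.trans hP_j).le))
    (fun h => UTi a (h.anti hAa.le))
    (not_strongAt_of_le (hval a) (hP_a.trans hAa).le)
    (fun h => hAs (h.anti hcai.le))
    (not_strongAt_of_le (hval a) (hP_a.trans hcai).le)
  refine ⟨Y, hY, hY', ?_⟩
  rcases h with h | ⟨h, -⟩ <;> rw [h] <;> assumption

/-- If `b` and `c` champion each other, then an improvement for `a` or a Pareto improvement
exists. -/
theorem false_of_mutual_champions [Fintype ι] {v : Fin 3 → Finset ι → ℝ}
    (hval : ∀ i, IsValuation (v i)) (hnd : ∀ i, NonDegenerate (v i))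
    (hc : ∀ i, Cancelable (v i)) {a b c : Fin 3} (hab : a ≠ b) (hac : a ≠ c) (hbc : b ≠ c)
    {X : Fin 3 → Finset ι} (hX : IsPartialAlloc X) (hEFX : IsEFX v X)
    (hno1 : ∀ Y : Fin 3 → Finset ι, IsPartialAlloc Y → IsEFX v Y → v a (Y a) ≤ v a (X a))
    (hno2 : ∀ Y : Fin 3 → Finset ι, IsPartialAlloc Y → IsEFX v Y → ¬ ParetoDominates v Y X)
    {g : ι} (hg : ∀ l, g ∉ X l) {Tb Tc : Finset ι}
    (hTb : Tb ⊆ insert g (X b)) (UTb : Unenvied v X Tb)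
    (hTc : Tc ⊆ insert g (X c)) (UTc : Unenvied v X Tc)
    (hcb : v c (X c) < v c Tb) (hbc' : v b (X b) < v b Tc) : False := by
  have Ua := hEFX.unenvied hval a
  have Tb_b := not_self_champion hval hX hEFX hno2 hg hab.symm hbc hac hTb UTb
  have Tc_c := not_self_champion hval hX hEFX hno2 hg hac.symm hbc.symm hab hTc UTc
  have dTb_a : Disjoint Tb (X a) :=
    (disjoint_insert_left.2 ⟨hg a, hX b a hab.symm⟩).mono_left hTb
  have dTb_c : Disjoint Tb (X c) :=
    (disjoint_insert_left.2 ⟨hg c, hX b c hbc⟩).mono_left hTb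
  have dTc_a : Disjoint Tc (X a) :=
    (disjoint_insert_left.2 ⟨hg a, hX c a hac.symm⟩).mono_left hTc
  have dTc_b : Disjoint Tc (X b) :=
    (disjoint_insert_left.2 ⟨hg b, hX c b hbc.symm⟩).mono_left hTc
  have Xc_b : v b (X c) ≤ v b (X b) := by
    by_contra! h
    exact false_of_pareto_improvement hno2 hbc hab.symm hac.symm dTb_c.symm (hX c a hac.symm)
      dTb_a (hEFX.unenvied hval c) UTb Ua h hcb.le le_rfl
  have Xb_c : v c (X b) ≤ v c (X c) := by
    by_contra! h
    exact false_of_pareto_improvement hno2 hbc.symm hac.symm hab.symm dTc_b.symm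
      (hX b a hab.symm) dTc_a (hEFX.unenvied hval b) UTc Ua h hbc'.le le_rfl
  have hgTb : g ∈ Tb := by
    by_contra h
    have := (hval c).2.2 ((subset_insert_iff_of_notMem h).1 hTb)
    linarith
  have hgTc : g ∈ Tc := by
    by_contra h
    have := (hval b).2.2 ((subset_insert_iff_of_notMem h).1 hTc)
    linarith
  obtain ⟨B, D, B', D', eTb, eXb, eTc, eXc, dBD, dBD', dBB', dB_D', dDB', dDD', gB, gD, gB', gD'⟩ :=
    exists_splits hTb hgTb (hg b) hTc hgTc (hg c) (hX b c hbc)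
  have gBs : Disjoint B {g} := by simpa using gB
  have gBs' : Disjoint B' {g} := by simpa using gB'
  have hD_b : v b {g} < v b D := by
    rw [← (hc b).union_lt_union_iff (hnd b) gBs dBD, ← eTb, ← eXb]
    exact lt_of_le_of_ne Tb_b (hnd b _ _ fun h => hg b (h ▸ hgTb))
  have hD'_b : v b D' < v b {g} := by
    rw [← (hc b).union_lt_union_iff (hnd b) dBD' gBs', ← eTc, ← eXc]
    exact Xc_b.trans_lt hbc'
  have hD'_c : v c {g} < v c D' := by
    rw [← (hc c).union_lt_union_iff (hnd c) gBs' dBD', ← eTc, ← eXc]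
    exact lt_of_le_of_ne Tc_c (hnd c _ _ fun h => hg c (h ▸ hgTc))
  have hD_c : v c D < v c {g} := by
    rw [← (hc c).union_lt_union_iff (hnd c) dBD gBs, ← eTb, ← eXb]
    exact Xb_c.trans_lt hcb
  have hP_b : v b (B ∪ D') < v b (X b) := by
    rw [eXb, (hc b).union_lt_union_iff (hnd b) dB_D' dBD]
    exact hD'_b.trans hD_b
  have hP_c : v c (X c) < v c (B ∪ D') := by
    refine hcb.trans ?_
    rwa [eTb, (hc c).union_lt_union_iff (hnd c) gBs dB_D']
  have hQ_b : v b (X b) < v b (B' ∪ D) := by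
    refine hbc'.trans ?_
    rwa [eTc, (hc b).union_lt_union_iff (hnd b) gBs' dDB'.symm]
  have hQ_c : v c (B' ∪ D) < v c (X c) := by
    rw [eXc, (hc c).union_lt_union_iff (hnd c) dDB'.symm dBD']
    exact hD_c.trans hD'_c
  have dba := hX b a hab.symm
  have dca := hX c a hac.symm
  rw [eXb, disjoint_union_left] at dba
  rw [eXc, disjoint_union_left] at dca
  have dPa : Disjoint (B ∪ D') (X a) := disjoint_union_left.2 ⟨dba.1, dca.2⟩
  have dQa : Disjoint (B' ∪ D) (X a) := disjoint_union_left.2 ⟨dca.1, dba.2⟩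
  have dPTc : Disjoint (B ∪ D') Tc := by
    rw [eTc]
    simp [dBB', dBD'.symm, gB, gD']
  have dQTb : Disjoint (B' ∪ D) Tb := by
    rw [eTb]
    simp [dBB'.symm, dBD.symm, gB', gD]
  obtain ⟨W, hW, UW, m, hm⟩ := exists_unenvied_subset v X hP_c
  have hWa : v a (X a) < v a W := by
    rcases eq_or_eq_or_eq_of_ne hab hac hbc m with rfl | rfl | rfl
    · exact hm
    · have := (hval m).2.2 hW
      linarith
    · exact (false_of_pareto_improvement hno2 hbc.symm hac.symm hab.symm
        (dPTc.mono_left hW) (dPa.mono_left hW) dTc_a UW UTc Ua hm hbc'.le le_rfl).elim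
  obtain ⟨Z, hZ, UZ, m', hm'⟩ := exists_unenvied_subset v X hQ_b
  have hQa : v a (X a) < v a (B' ∪ D) := by
    rcases eq_or_eq_or_eq_of_ne hab hac hbc m' with rfl | rfl | rfl
    · exact hm'.trans_le ((hval m').2.2 hZ)
    · exact (false_of_pareto_improvement hno2 hbc hab.symm hac.symm
        (dQTb.mono_left hZ) (dQa.mono_left hZ) dTb_a UZ UTb Ua hm' hcb.le le_rfl).elim
    · have := (hval m').2.2 hZ
      linarith
  rcases exists_improvement_or_complete hval hnd hc hab hac hbc (dPa.mono_left hW)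
    (dPTc.mono_left hW) dTc_a.symm hWa (UW a) (UTc a) (fun h => UW b (h.anti hbc'.le))
    (fun h => Ua b (h.anti hbc'.le)) with
    ⟨Y, hY, hY', hlt⟩ | ⟨Y, hY, hY', hU, hYa, q, hq, hYq⟩
  · exact absurd hlt (not_lt.2 (hno1 Y hY hY'))
  obtain ⟨r, har, hqr⟩ := exists_third a q
  have hsub : insert g (B' ∪ D) ⊆ Y r := by
    refine subset_of_unalloc_eq_empty hU hq.symm har hqr ?_ ?_
    · rw [hYa]
      exact disjoint_insert_left.2 ⟨hg a, dQa⟩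
    · rw [hYq]
      refine disjoint_of_subset_right hW ?_
      simp [dBB'.symm, dBD', dBD.symm, dDD', gB, gD']
  refine hY' a r har (strongAt_of_ssubset (hval a) (A := B' ∪ D) ?_
    ((ssubset_insert ?_).trans_subset hsub))
  · rwa [hYa]
  · simp [gB', gD]

/-- Given an unallocated item, a chosen agent `a` can be improved or there is a Pareto
improvement. -/
theorem exists_improvement [Fintype ι] {v : Fin 3 → Finset ι → ℝ}
    (hval : ∀ i, IsValuation (v i)) (hnd : ∀ i, NonDegenerate (v i))
    (hc : ∀ i, Cancelable (v i)) (a : Fin 3)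
    {X : Fin 3 → Finset ι} (hX : IsPartialAlloc X) (hEFX : IsEFX v X)
    (hU : (unalloc X).Nonempty) :
    (∃ Y : Fin 3 → Finset ι, IsPartialAlloc Y ∧ IsEFX v Y ∧ v a (X a) < v a (Y a)) ∨
    (∃ Y : Fin 3 → Finset ι, IsPartialAlloc Y ∧ IsEFX v Y ∧ ParetoDominates v Y X) := by
  by_contra hno
  push Not at hno
  obtain ⟨hno1, hno2⟩ := hno
  have hXa : ∀ p, v a (X p) ≤ v a (X a) := by
    intro p
    by_contra! h
    have hap : a ≠ p := by
      rintro rfl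
      exact lt_irrefl _ h
    rcases exists_improvement_or_complete_of_envy hval hnd hc hap hX hEFX h with
      ⟨Y, hY, hY', hlt⟩ | ⟨Y, hY, hY', hYU, -, -, hle⟩
    · exact absurd hlt (not_lt.2 (hno1 Y hY hY'))
    · refine hno2 Y hY hY' ⟨hle, ?_⟩
      by_contra! h'
      have hYX : Y = X := by
        funext l
        by_contra hne
        exact hnd l _ _ hne (le_antisymm (h' l) (hle l))
      rw [hYX] at hYU
      exact hU.ne_empty hYU
  obtain ⟨g, hg⟩ := hU
  rw [mem_unalloc_iff] at hg
  obtain ⟨T, hT⟩ : ∃ T : Fin 3 → Finset ι, ∀ s, T s ⊆ insert g (X s) ∧ Unenvied v X (T s) ∧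
      ∃ l, v l (X l) < v l (T s) := by
    choose T hT using fun s => exists_champion hval hnd X (hg s)
    exact ⟨T, hT⟩
  have hself : ∀ s, v s (T s) ≤ v s (X s) := by
    intro s
    obtain ⟨y, hsy, -⟩ := exists_third s s
    obtain ⟨z, hsz, hyz⟩ := exists_third s y
    exact not_self_champion hval hX hEFX hno2 hg hsy hsz hyz (hT s).1 (hT s).2.1
  have chain : ∀ j i, a ≠ j → a ≠ i → j ≠ i → v a (X a) < v a (T j) →
      v j (T i) ≤ v j (X j) := by
    intro j i haj hai hji h
    by_contra! h'
    exact false_of_champion_chain hval hnd hc haj hai hji hX hEFX hno1 hno2 hg (hXa j)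
      (hT j).1 (hT j).2.1 (hT i).1 (hT i).2.1 h h'
  have main : ∀ j i, a ≠ j → a ≠ i → j ≠ i → v a (T j) ≤ v a (X a) := by
    intro j i haj hai hji
    by_contra! hcaj
    have cycle : ∀ j i, a ≠ j → a ≠ i → j ≠ i → v a (X a) < v a (T i) →
        v a (X a) < v a (T j) → v j (T a) ≤ v j (X j) := by
      intro j i haj hai hji hcai hcaj
      by_contra! hcja
      obtain ⟨Y, hY, hY', hlt⟩ := exists_improvement_of_champion_cycle hval hnd hc haj hai hji
        hX hEFX hno2 hg (hXa j) (hT a).1 (hT a).2.1 (hT j).1 (hT j).2.1 (hT i).1 (hT i).2.1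
        hcai hcaj hcja
      exact absurd hlt (not_lt.2 (hno1 Y hY hY'))
    have hcai : v a (X a) < v a (T i) := by
      obtain ⟨l, hl⟩ := (hT i).2.2
      rcases eq_or_eq_or_eq_of_ne haj hai hji l with rfl | rfl | rfl
      · exact hl
      · exact absurd hl (not_lt.2 (chain l i haj hai hji hcaj))
      · exact absurd hl (not_lt.2 (hself l))
    obtain ⟨l, hl⟩ := (hT a).2.2
    rcases eq_or_eq_or_eq_of_ne haj hai hji l with rfl | rfl | rfl
    · exact absurd hl (not_lt.2 (hself l))
    · exact absurd hl (not_lt.2 (cycle l i haj hai hji hcai hcaj))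
    · exact absurd hl (not_lt.2 (cycle l j hai haj hji.symm hcaj hcai))
  obtain ⟨b, hab, -⟩ := exists_third a a
  obtain ⟨c, hac, hbc⟩ := exists_third a b
  have champ : ∀ j i, a ≠ j → a ≠ i → j ≠ i → v i (X i) < v i (T j) := by
    intro j i haj hai hji
    obtain ⟨l, hl⟩ := (hT j).2.2
    rcases eq_or_eq_or_eq_of_ne haj hai hji l with rfl | rfl | rfl
    · exact absurd hl (not_lt.2 (main j i haj hai hji))
    · exact absurd hl (not_lt.2 (hself l))
    · exact hl
  exact false_of_mutual_champions hval hnd hc hab hac hbc hX hEFX hno1 hno2 hg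
    (hT b).1 (hT b).2.1 (hT c).1 (hT c).2.1 (champ b c hab hac hbc) (champ c b hac hab hbc.symm)

end ThreeAgents

/-- Fix an arbitrary ordering of 3 agents whose valuations are
non-degenerate and cancelable.  If `X` is a partial EFX allocation with at least
one unallocated item, then some partial EFX allocation `Y` dominates `X`. -/
theorem efx_three_agents_dominating_allocation
    {ι : Type*} [DecidableEq ι] [Fintype ι]
    (v : Fin 3 → Finset ι → ℝ) (hval : ∀ i, IsValuation (v i))
    (hnd : ∀ i, NonDegenerate (v i)) (hc : ∀ i, Cancelable (v i))
    (a : Fin 3 → Fin 3) (ha : Function.Bijective a)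
    (X : Fin 3 → Finset ι) (hX : IsPartialAlloc X) (hEFX : IsEFX v X)
    (hU : 1 ≤ (unalloc X).card) :
    ∃ Y : Fin 3 → Finset ι, IsPartialAlloc Y ∧ IsEFX v Y ∧ Dominates v a Y X := by
  rcases exists_improvement hval hnd hc (a 0) hX hEFX (card_pos.1 hU) with
    ⟨Y, hY, hY', hlt⟩ | ⟨Y, hY, hY', hP⟩
  · exact ⟨Y, hY, hY', 0, fun j hj => absurd hj (Fin.not_lt_zero j), hlt⟩
  · exact ⟨Y, hY, hY', hP.dominates ha⟩

end FairDivision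
end
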